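/- Let d ≥ 1, m ∈ ℝ, and 0 < p, q ≤ ∞ with either 0 < p < ∞ or p = q = ∞. Suppose s ≤ τ_{p,q} := d/min(1,p,q) − d. Then there exists a symbol a ∈ S^m_{1,1} such that for every constant C > 0 there is a Schwartz function f with ‖T_a f‖_{F_p^{s,q}} > C ‖f‖_{F_p^{s+m,q}}; that is, the operator norm of T_a from F_p^{s+m,q} to F_p^{s,q} is infinite. -/

import Mathlib

noncomputable section

open MeasureTheory SchwartzMap Complex RealInnerProductSpace Filter
open scoped ENNReal NNReal ContDiff SchwartzMap

/-- Euclidean space `ℝ^d`. -/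
abbrev RD (d : ℕ) : Type := EuclideanSpace ℝ (Fin d)

/-- Tempered distributions on `ℝ^d`. -/
abbrev TD (d : ℕ) : Type := 𝓢(RD d, ℂ) →L[ℂ] ℂ

/-- Fourier transform of a Schwartz function (with the convention
`f̂(ξ) = ∫ f(x) e^{-2πi⟨x,ξ⟩} dx`). -/
def fourierS {d : ℕ} (f : 𝓢(RD d, ℂ)) : 𝓢(RD d, ℂ) :=
  SchwartzMap.fourierTransformCLM ℂ f

/-- Hörmander symbol class `S^m_{1,1}`: `a` is smooth and
`‖∂_ξ^α ∂_x^β a(x,ξ)‖ ≤ c_{α,β} (1+‖ξ‖)^{m-|α|+|β|}` for all orders of derivatives. -/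
def IsSymbolS11 (d : ℕ) (m : ℝ) (a : RD d → RD d → ℂ) : Prop :=
  ContDiff ℝ ∞ (fun p : RD d × RD d => a p.1 p.2) ∧
  ∀ α β : ℕ, ∃ c : ℝ, ∀ x ξ : RD d,
    ‖iteratedFDeriv ℝ α (fun ξ' => iteratedFDeriv ℝ β (fun x' => a x' ξ') x) ξ‖
      ≤ c * (1 + ‖ξ‖) ^ (m - (α : ℝ) + (β : ℝ))

/-- The pseudo-differential operator `T_a f(x) = ∫ a(x,ξ) f̂(ξ) e^{2πi⟨x,ξ⟩} dξ`
acting on a Schwartz function `f`. -/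
def pdo {d : ℕ} (a : RD d → RD d → ℂ) (f : 𝓢(RD d, ℂ)) (x : RD d) : ℂ :=
  ∫ ξ, a x ξ * fourierS f ξ * Complex.exp (2 * Real.pi * Complex.I * ((⟪x, ξ⟫ : ℝ) : ℂ))

/-- Littlewood–Paley data: a Schwartz function `φ` with `φ̂` supported in
`{1/2 ≤ |ξ| ≤ 2}` and `Σ_{k∈ℤ} φ̂(2^{-k}ξ) = 1` for `ξ ≠ 0`, together with the
low-frequency piece `Φ` determined by `Φ̂ = 1 - Σ_{k≥1} φ̂(2^{-k}·)`. -/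
structure LPData (d : ℕ) where
  φ : 𝓢(RD d, ℂ)
  Φ : 𝓢(RD d, ℂ)
  supp_φ : ∀ ξ : RD d, fourierS φ ξ ≠ 0 → 1/2 ≤ ‖ξ‖ ∧ ‖ξ‖ ≤ 2
  sum_φ : ∀ ξ : RD d, ξ ≠ 0 → HasSum (fun k : ℤ => fourierS φ ((2:ℝ)^(-k) • ξ)) 1
  Φ_def : ∀ ξ : RD d, fourierS Φ ξ = 1 - ∑' k : ℕ, fourierS φ (((2:ℝ)^(k+1))⁻¹ • ξ)

/-- The Littlewood–Paley convolution kernel: `Φ` for `k = 0` and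
`φ_k = 2^{kd} φ(2^k ·)` for `k ≥ 1`. -/
def LPkernel {d : ℕ} (D : LPData d) : ℕ → RD d → ℂ
  | 0, x => D.Φ x
  | (k+1), x => (((2:ℝ)^((k+1) * d) : ℝ) : ℂ) * D.φ ((2:ℝ)^(k+1) • x)

/-- The Fourier transform of the `k`-th Littlewood–Paley kernel, i.e. `φ̂_k = φ̂(2^{-k}·)`
for `k ≥ 1` and `Φ̂` for `k = 0`. -/
def LPhat {d : ℕ} (D : LPData d) : ℕ → RD d → ℂ
  | 0, ξ => fourierS D.Φ ξ
  | (k+1), ξ => fourierS D.φ (((2:ℝ)^(k+1))⁻¹ • ξ)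

/-- Littlewood–Paley operator `Π_k g = φ_k ∗ g` (with `φ_0 := Φ`) acting on functions. -/
def LP {d : ℕ} (D : LPData d) (k : ℕ) (g : RD d → ℂ) (x : RD d) : ℂ :=
  ∫ y, LPkernel D k y * g (x - y)

/-- `Π*_k = Π_{k-1} + Π_k + Π_{k+1}` (with the convention `φ_{-1} := 0`). -/
def LPstar {d : ℕ} (D : LPData d) (k : ℕ) (g : RD d → ℂ) (x : RD d) : ℂ :=
  (if k = 0 then 0 else LP D (k-1) g x) + LP D k g x + LP D (k+1) g x

open Classical in
/-- Pairing of a tempered distribution with a plain function: it gives `u ψ` if the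
function is (the coercion of) a Schwartz function `ψ`, and `0` otherwise. -/
def pairing {d : ℕ} (u : TD d) (g : RD d → ℂ) : ℂ :=
  if h : ∃ ψ : 𝓢(RD d, ℂ), ⇑ψ = g then u h.choose else 0

/-- Fourier transform of a tempered distribution, `⟨û, ψ⟩ = ⟨u, ψ̂⟩`. -/
def fourierTD {d : ℕ} (u : TD d) : TD d :=
  u.comp (SchwartzMap.fourierTransformCLM ℂ)

/-- Littlewood–Paley operator on tempered distributions:
`Π_k u (x) = ⟨u, φ_k(x - ·)⟩`. -/
def LPdist {d : ℕ} (D : LPData d) (k : ℕ) (u : TD d) (x : RD d) : ℂ :=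
  pairing u (fun y => LPkernel D k (x - y))

/-- The symbol `a_{j,k}(x,ξ) = (φ_j ∗ a(·,ξ))(x) · φ̂_k(ξ)` (with `Φ` replacing `φ_0`). -/
def symbolPiece {d : ℕ} (D : LPData d) (a : RD d → RD d → ℂ) (j k : ℕ)
    (x ξ : RD d) : ℂ :=
  (∫ y, LPkernel D j y * a (x - y) ξ) * LPhat D k ξ

/-- `T_{a_{j,k}} u (x) = ⟨û, a_{j,k}(x,·) e^{2πi⟨x,·⟩}⟩` for a tempered distribution `u`. -/
def pdoPieceD {d : ℕ} (D : LPData d) (a : RD d → RD d → ℂ) (j k : ℕ)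
    (u : TD d) (x : RD d) : ℂ :=
  pairing (fourierTD u)
    (fun ξ => symbolPiece D a j k x ξ * Complex.exp (2 * Real.pi * Complex.I * ((⟪x, ξ⟫ : ℝ) : ℂ)))

/-- Partial sums `Σ_{j=0}^N Σ_{k=0}^N T_{a_{j,k}} u (x)`. -/
def pdoPartial {d : ℕ} (D : LPData d) (a : RD d → RD d → ℂ) (N : ℕ)
    (u : TD d) (x : RD d) : ℂ :=
  ∑ j ∈ Finset.range (N+1), ∑ k ∈ Finset.range (N+1), pdoPieceD D a j k u x

/-- `T_a u` converges in `S'` to the tempered distribution `Tf`: the partial sums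
`Σ_{j,k≤N} T_{a_{j,k}} u` (which are functions) converge to `Tf` weakly. -/
def ConvergesInSPrime {d : ℕ} (D : LPData d) (a : RD d → RD d → ℂ)
    (u : TD d) (Tf : TD d) : Prop :=
  ∀ ψ : 𝓢(RD d, ℂ),
    Tendsto (fun N => ∫ x, pdoPartial D a N u x * ψ x) atTop (nhds (Tf ψ))

/-- The dyadic cube of level `ν` (side length `2^{-ν}`) indexed by `n ∈ ℤ^d`. -/
def dyadicCube (d : ℕ) (ν : ℤ) (n : Fin d → ℤ) : Set (RD d) :=
  {x | ∀ i, (n i : ℝ) * (2:ℝ)^(-ν) ≤ x i ∧ x i < ((n i : ℝ) + 1) * (2:ℝ)^(-ν)}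

/-- The local quantity `(|P|⁻¹ ∫_P Σ_{k=k₀}^∞ 2^{skq} ‖g_k(x)‖^q dx)^{1/q}` for the
dyadic cube `P` of level `μ` indexed by `n` (so that `|P|⁻¹ = 2^{μd}`). -/
def cubePiece (d : ℕ) (μ : ℕ) (n : Fin d → ℤ) (k₀ : ℕ) (s q : ℝ)
    (g : ℕ → RD d → ℂ) : ℝ≥0∞ :=
  ((2:ℝ≥0∞)^((μ:ℝ)*(d:ℝ)) *
    ∫⁻ x in dyadicCube d μ n,
      ∑' j : ℕ, (2:ℝ≥0∞)^(s*((k₀:ℝ)+(j:ℝ))*q) * (‖g (k₀+j) x‖₊ : ℝ≥0∞)^q) ^ (1/q)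

/-- The `F_∞^{s,q}` norm (for `q < ∞`) of a function, computed from its
Littlewood–Paley pieces:
`‖Π_0 g‖_∞ + sup_{l(P)<1 dyadic} (|P|⁻¹ ∫_P Σ_{k=-log₂ l(P)}^∞ 2^{skq}|Π_k g|^q)^{1/q}`. -/
def FinftyNormFun {d : ℕ} (D : LPData d) (s q : ℝ) (g : RD d → ℂ) : ℝ≥0∞ :=
  (⨆ x : RD d, (‖LP D 0 g x‖₊ : ℝ≥0∞)) +
  ⨆ (μ : ℕ) (_ : 1 ≤ μ) (n : Fin d → ℤ),
    cubePiece d μ n μ s q (fun k x => LP D k g x)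

/-- The `F_∞^{s,q}` norm (for `q < ∞`) of a tempered distribution. -/
def FinftyNormDist {d : ℕ} (D : LPData d) (s q : ℝ) (u : TD d) : ℝ≥0∞ :=
  (⨆ x : RD d, (‖LPdist D 0 u x‖₊ : ℝ≥0∞)) +
  ⨆ (μ : ℕ) (_ : 1 ≤ μ) (n : Fin d → ℤ),
    cubePiece d μ n μ s q (fun k x => LPdist D k u x)

/-- The (axis-parallel, closed) cube with corner `c` and side length `L`. -/
def cube (d : ℕ) (c : RD d) (L : ℝ) : Set (RD d) :=
  {x | ∀ i, c i ≤ x i ∧ x i ≤ c i + L}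

/-- The average of `g` over the cube with corner `c` and side length `L`. -/
def cubeMean {d : ℕ} (c : RD d) (L : ℝ) (g : RD d → ℂ) : ℂ :=
  (L^d)⁻¹ • ∫ x in cube d c L, g x

/-- The `bmo` norm (local BMO):
`sup_{l(Q)≥1} |Q|⁻¹∫_Q |g| + sup_{l(Q)<1} |Q|⁻¹∫_Q |g - g_Q|`, over all cubes `Q`. -/
def bmoNorm (d : ℕ) (g : RD d → ℂ) : ℝ≥0∞ :=
  (⨆ (c : RD d) (L : ℝ) (_ : 1 ≤ L),
    ENNReal.ofReal ((L^d)⁻¹) * ∫⁻ x in cube d c L, (‖g x‖₊ : ℝ≥0∞)) +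
  (⨆ (c : RD d) (L : ℝ) (_ : 0 < L) (_ : L < 1),
    ENNReal.ofReal ((L^d)⁻¹) * ∫⁻ x in cube d c L, (‖g x - cubeMean c L g‖₊ : ℝ≥0∞))

/-- The Peetre maximal function `𝔐_{σ,R} g(x) = sup_y ‖g(x-y)‖/(1+R‖y‖)^σ`. -/
def peetre {d : ℕ} (σ R : ℝ) (g : RD d → ℂ) (x : RD d) : ℝ≥0∞ :=
  ⨆ y : RD d, (‖g (x - y)‖₊ : ℝ≥0∞) / ENNReal.ofReal ((1 + R * ‖y‖) ^ σ)

/-- `g` has (distributional) Fourier support contained in `K`: the pairing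
`⟨ĝ, ψ⟩ = ∫ g · ψ̂` vanishes for every Schwartz `ψ` whose support does not meet `K`. -/
def HasFourierSupportIn {d : ℕ} (g : RD d → ℂ) (K : Set (RD d)) : Prop :=
  ∀ ψ : 𝓢(RD d, ℂ), tsupport ⇑ψ ∩ K = ∅ → ∫ x, g x * fourierS ψ x = 0

/-- The `L^p` (quasi-)norm for `p ∈ (0,∞]` (with `sup` for `p = ∞`). -/
def lpNormFun (d : ℕ) (p : ℝ≥0∞) (g : RD d → ℂ) : ℝ≥0∞ :=
  if p = (⊤ : ℝ≥0∞) then ⨆ x : RD d, (‖g x‖₊ : ℝ≥0∞)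
  else (∫⁻ x, (‖g x‖₊ : ℝ≥0∞) ^ p.toReal) ^ (1/p.toReal)

/-- The Triebel–Lizorkin norm `‖g‖_{F_p^{s,q}}` for `0 < p < ∞`, `0 < q ≤ ∞`, with the
convention `‖g‖_{F_∞^{s,∞}} = ‖g‖_{B_∞^{s,∞}} = sup_{k≥0} 2^{sk}‖Π_k g‖_∞` when `p = ∞`. -/
def TLNorm {d : ℕ} (D : LPData d) (s : ℝ) (p q : ℝ≥0∞) (g : RD d → ℂ) : ℝ≥0∞ :=
  if p = (⊤ : ℝ≥0∞) then ⨆ k : ℕ, (2:ℝ≥0∞)^(s*(k:ℝ)) * ⨆ x : RD d, (‖LP D k g x‖₊ : ℝ≥0∞)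
  else lpNormFun d p (LP D 0 g) +
    (if q = (⊤ : ℝ≥0∞) then
      (∫⁻ x, (⨆ k : ℕ, (2:ℝ≥0∞)^(s*((k:ℝ)+1)) * (‖LP D (k+1) g x‖₊ : ℝ≥0∞)) ^ p.toReal)
        ^ (1/p.toReal)
     else
      (∫⁻ x, ((∑' k : ℕ, ((2:ℝ≥0∞)^(s*((k:ℝ)+1)) * (‖LP D (k+1) g x‖₊ : ℝ≥0∞)) ^ q.toReal)
          ^ (1/q.toReal)) ^ p.toReal) ^ (1/p.toReal))

/-- The Besov norm `‖g‖_{B_p^{s,q}}` for `0 < p, q ≤ ∞`. -/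
def BesovNorm {d : ℕ} (D : LPData d) (s : ℝ) (p q : ℝ≥0∞) (g : RD d → ℂ) : ℝ≥0∞ :=
  lpNormFun d p (LP D 0 g) +
    (if q = (⊤ : ℝ≥0∞) then ⨆ k : ℕ, (2:ℝ≥0∞)^(s*((k:ℝ)+1)) * lpNormFun d p (LP D (k+1) g)
     else (∑' k : ℕ, ((2:ℝ≥0∞)^(s*((k:ℝ)+1)) * lpNormFun d p (LP D (k+1) g)) ^ q.toReal)
       ^ (1/q.toReal))

/-! ### The symbol -/

/-- The pure frequency `x ↦ e^{-2πi⟨x,v⟩}`. -/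
def modulation {d : ℕ} (v x : RD d) : ℂ :=
  Complex.exp (-(2 * Real.pi * Complex.I * ((⟪x, v⟫ : ℝ) : ℂ)))

lemma contDiff_modulation {d : ℕ} (v : RD d) : ContDiff ℝ ∞ (modulation v) := by
  unfold modulation
  have h : ContDiff ℝ ∞ (fun x : RD d => ((⟪x, v⟫ : ℝ) : ℂ)) :=
    Complex.ofRealCLM.contDiff.comp (contDiff_id.inner ℝ contDiff_const)
  exact ((contDiff_const.mul h).neg).cexp

lemma norm_iteratedFDeriv_comp_clm_le {E F G : Type*} [NormedAddCommGroup E] [NormedSpace ℝ E]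
    [NormedAddCommGroup F] [NormedSpace ℝ F] [NormedAddCommGroup G] [NormedSpace ℝ G]
    {g : F → G} (hg : ContDiff ℝ ∞ g) (L : E →L[ℝ] F) (n : ℕ) (x : E) :
    ‖iteratedFDeriv ℝ n (fun y => g (L y)) x‖ ≤ ‖L‖ ^ n * ‖iteratedFDeriv ℝ n g (L x)‖ := by
  have h := L.iteratedFDeriv_comp_right hg x (i := n) (by exact_mod_cast le_top)
  change ‖iteratedFDeriv ℝ n (g ∘ L) x‖ ≤ _
  rw [h, mul_comm]
  refine (ContinuousMultilinearMap.norm_compContinuousLinearMap_le _ _).trans ?_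
  simp

lemma norm_iteratedFDeriv_modulation_le {d : ℕ} (v : RD d) (n : ℕ) (x : RD d) :
    ‖iteratedFDeriv ℝ n (modulation v) x‖ ≤ (2 * Real.pi * ‖v‖) ^ n := by
  set c : ℂ := -(2 * Real.pi * Complex.I) with hc
  have hcn : ‖c‖ = 2 * Real.pi := by
    simp [hc, abs_of_pos Real.pi_pos]
  set g : ℝ → ℂ := fun t => Complex.exp (c * t) with hg
  have hgs : ContDiff ℝ ∞ g := (contDiff_const.mul Complex.ofRealCLM.contDiff).cexp
  have hder : ∀ n : ℕ, iteratedDeriv n g = fun t => c ^ n * g t := by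
    intro n
    induction n with
    | zero => simp
    | succ n ih =>
      rw [iteratedDeriv_succ, ih]
      funext t
      have h1 : HasDerivAt g (Complex.exp (c * t) * (c * 1)) t :=
        (((hasDerivAt_id' t).ofReal_comp).const_mul c).cexp
      rw [(h1.const_mul (c ^ n)).deriv]
      simp only [hg]; ring
  have hmod : modulation v = fun x => g ((innerSL ℝ v) x) := by
    funext x
    simp only [modulation, hg, hc, innerSL_apply_apply, real_inner_comm x v]
    congr 1; ring
  rw [hmod]
  refine (norm_iteratedFDeriv_comp_clm_le hgs _ n x).trans ?_
  rw [norm_iteratedFDeriv_eq_norm_iteratedDeriv, hder, innerSL_apply_norm]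
  have : ‖g ((innerSL ℝ v) x)‖ = 1 := by
    simp only [hg, hc, Complex.norm_exp]; simp
  rw [norm_mul, this, norm_pow, hcn, mul_pow]
  exact le_of_eq (by ring)

/-- A smooth cutoff adapted to the unit vector `u`. -/
def cutoff {d : ℕ} (u : RD d) : ContDiffBump u where
  rIn := 1 / 8
  rOut := 1 / 4
  rIn_pos := by norm_num
  rIn_lt_rOut := by norm_num

/-- The `k`-th dyadic piece of the symbol: it moves the frequency `2^k u` to the origin. -/
def shiftPiece {d : ℕ} (u : RD d) (m : ℝ) (k : ℕ) (x ξ : RD d) : ℂ :=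
  cutoff u (((2:ℝ) ^ k)⁻¹ • ξ) • ((((2:ℝ) ^ k) ^ m : ℝ) * modulation ((2:ℝ) ^ k • u) x)

/-- The symbol `∑_k 2^{km} e^{-2πi⟨x,2^k u⟩} χ(2^{-k}ξ)`. -/
def shiftSymbol {d : ℕ} (u : RD d) (m : ℝ) (x ξ : RD d) : ℂ :=
  ∑' k : ℕ, shiftPiece u m k x ξ

lemma norm_mem_of_cutoff_ne_zero {d : ℕ} {u : RD d} (hu : ‖u‖ = 1) {k : ℕ} {ξ : RD d}
    (h : cutoff u (((2:ℝ) ^ k)⁻¹ • ξ) ≠ 0) :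
    3 / 4 * 2 ^ k < ‖ξ‖ ∧ ‖ξ‖ < 5 / 4 * 2 ^ k := by
  have h1 : ((2:ℝ) ^ k)⁻¹ • ξ ∈ Metric.ball u (1 / 4) := by
    have : ((2:ℝ) ^ k)⁻¹ • ξ ∈ Function.support (cutoff u) := h
    rwa [(cutoff u).support_eq] at this
  rw [mem_ball_iff_norm] at h1
  have h2 : ‖((2:ℝ) ^ k)⁻¹ • ξ‖ = (2 ^ k)⁻¹ * ‖ξ‖ := by
    rw [norm_smul]; simp
  have h3 := abs_norm_sub_norm_le (((2:ℝ) ^ k)⁻¹ • ξ) u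
  rw [h2, hu] at h3
  have h4 := abs_lt.1 (h3.trans_lt h1)
  have hk : (0:ℝ) < 2 ^ k := by positivity
  have h5 : ‖ξ‖ = 2 ^ k * ((2 ^ k)⁻¹ * ‖ξ‖) := by field_simp
  constructor <;> rw [h5] <;> nlinarith [h4.1, h4.2]

lemma cutoff_scale_unique {d : ℕ} {u : RD d} (hu : ‖u‖ = 1) {k k₀ : ℕ} {ξ : RD d}
    (hlo : k₀ = 0 ∨ 5 / 8 * 2 ^ k₀ < ‖ξ‖) (hhi : ‖ξ‖ < 3 / 2 * 2 ^ k₀) (hk : k ≠ k₀) :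
    cutoff u (((2:ℝ) ^ k)⁻¹ • ξ) = 0 := by
  by_contra hne
  obtain ⟨h1, h2⟩ := norm_mem_of_cutoff_ne_zero hu hne
  rcases lt_or_gt_of_ne hk with hlt | hgt
  · rcases hlo with h0 | hlo
    · omega
    · have : (2:ℝ) ^ (k + 1) ≤ 2 ^ k₀ := pow_le_pow_right₀ (by norm_num) hlt
      rw [pow_succ] at this
      linarith
  · have : (2:ℝ) ^ (k₀ + 1) ≤ 2 ^ k := pow_le_pow_right₀ (by norm_num) hgt
    rw [pow_succ] at this
    linarith

lemma exists_dyadic_annulus (r : ℝ) (hr : 0 ≤ r) :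
    ∃ k₀ : ℕ, (k₀ = 0 ∨ 5 / 8 * 2 ^ k₀ < r) ∧ r < 3 / 2 * 2 ^ k₀ := by
  have hex : ∃ k : ℕ, r < 3 / 2 * 2 ^ k := by
    obtain ⟨k, hk⟩ := pow_unbounded_of_one_lt r (by norm_num : (1:ℝ) < 2)
    exact ⟨k, by nlinarith [pow_pos (by norm_num : (0:ℝ) < 2) k]⟩
  classical
  refine ⟨Nat.find hex, ?_, Nat.find_spec hex⟩
  rcases Nat.eq_zero_or_pos (Nat.find hex) with h0 | h0
  · exact Or.inl h0
  · right
    obtain ⟨n, hn⟩ := Nat.exists_eq_succ_of_ne_zero h0.ne'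
    have := Nat.find_min hex (m := n) (by omega)
    rw [hn, Nat.succ_eq_add_one, pow_succ]
    have : (0:ℝ) < 2 ^ n := by positivity
    linarith

lemma shiftSymbol_eventually_eq {d : ℕ} {u : RD d} (hu : ‖u‖ = 1) (m : ℝ) (ξ₀ : RD d) :
    ∃ k₀ : ℕ, ∀ᶠ ξ in nhds ξ₀, ∀ x, shiftSymbol u m x ξ = shiftPiece u m k₀ x ξ := by
  obtain ⟨k₀, hlo, hhi⟩ := exists_dyadic_annulus ‖ξ₀‖ (norm_nonneg _)
  refine ⟨k₀, ?_⟩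
  have h1 : ∀ᶠ ξ in nhds ξ₀, ‖ξ‖ < 3 / 2 * 2 ^ k₀ :=
    continuous_norm.continuousAt.eventually_lt continuousAt_const hhi
  have h2 : ∀ᶠ ξ in nhds ξ₀, (k₀ = 0 ∨ 5 / 8 * 2 ^ k₀ < ‖ξ‖) := by
    rcases hlo with h | h
    · exact Eventually.of_forall fun _ => Or.inl h
    · exact (continuousAt_const.eventually_lt continuous_norm.continuousAt h).mono
        fun _ => Or.inr
  filter_upwards [h1, h2] with ξ hξ1 hξ2 x
  refine tsum_eq_single k₀ fun k hk => ?_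
  rw [shiftPiece, cutoff_scale_unique hu hξ2 hξ1 hk, zero_smul]

lemma rpow_le_of_comparable {X Y : ℝ} (hX : 0 < X) (hY : 0 < Y) (h1 : X ≤ 4 * Y)
    (h2 : Y ≤ 4 * X) (e : ℝ) : X ^ e ≤ 4 ^ |e| * Y ^ e := by
  rcases le_total 0 e with he | he
  · rw [abs_of_nonneg he, ← Real.mul_rpow (by norm_num) hY.le]
    exact Real.rpow_le_rpow hX.le h1 he
  · have h3 : Y / 4 ≤ X := by linarith
    calc X ^ e ≤ (Y / 4) ^ e := Real.rpow_le_rpow_of_nonpos (by positivity) h3 he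
      _ = 4 ^ |e| * Y ^ e := by
        rw [abs_of_nonpos he, Real.div_rpow hY.le (by norm_num), Real.rpow_neg (by norm_num)]
        field_simp

lemma contDiff_cutoff_scale {d : ℕ} (u : RD d) (c : ℝ) :
    ContDiff ℝ ∞ (fun ξ : RD d => cutoff u (c • ξ)) :=
  (cutoff u).contDiff.comp (contDiff_const_smul c)

lemma contDiff_shiftPiece {d : ℕ} (u : RD d) (m : ℝ) (k : ℕ) :
    ContDiff ℝ ∞ (fun p : RD d × RD d => shiftPiece u m k p.1 p.2) := by
  unfold shiftPiece
  exact ((contDiff_cutoff_scale u _).comp contDiff_snd).smul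
    (contDiff_const.mul ((contDiff_modulation _).comp contDiff_fst))

lemma iteratedFDeriv_shiftPiece {d : ℕ} (u : RD d) (m : ℝ) (k β : ℕ) (x ξ : RD d) :
    iteratedFDeriv ℝ β (fun x' => shiftPiece u m k x' ξ) x =
      cutoff u (((2:ℝ) ^ k)⁻¹ • ξ) • ((((2:ℝ) ^ k) ^ m : ℝ) •
        iteratedFDeriv ℝ β (modulation ((2:ℝ) ^ k • u)) x) := by
  have hs : ContDiff ℝ β (modulation ((2:ℝ) ^ k • u)) :=
    (contDiff_modulation _).of_le (by exact_mod_cast le_top)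
  have : (fun x' => shiftPiece u m k x' ξ) = (cutoff u (((2:ℝ) ^ k)⁻¹ • ξ) *
      (((2:ℝ) ^ k) ^ m : ℝ)) • (modulation ((2:ℝ) ^ k • u)) := by
    funext x'
    simp [shiftPiece, mul_assoc]
  rw [this, iteratedFDeriv_const_smul_apply hs.contDiffAt, mul_smul]

lemma isSymbolS11_shiftSymbol {d : ℕ} {u : RD d} (hu : ‖u‖ = 1) (m : ℝ) :
    IsSymbolS11 d m (shiftSymbol u m) := by
  refine ⟨?_, fun α β => ?_⟩
  · rw [contDiff_iff_contDiffAt]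
    rintro ⟨x₀, ξ₀⟩
    obtain ⟨k₀, hk⟩ := shiftSymbol_eventually_eq hu m ξ₀
    refine (contDiff_shiftPiece u m k₀).contDiffAt.congr_of_eventuallyEq ?_
    have := (continuous_snd (X := RD d) (Y := RD d)).continuousAt (x := (x₀, ξ₀))
    exact (this.eventually hk).mono fun p hp => hp p.1
  · have hcs : HasCompactSupport (iteratedFDeriv ℝ α (cutoff u)) :=
      (cutoff u).hasCompactSupport.iteratedFDeriv α
    have hcont : Continuous (iteratedFDeriv ℝ α (cutoff u)) :=
      ((cutoff u).contDiff (n := ⊤)).continuous_iteratedFDeriv (by exact_mod_cast le_top)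
    obtain ⟨A, hA⟩ := hcs.exists_bound_of_continuous hcont
    have hA0 : 0 ≤ A := (norm_nonneg _).trans (hA 0)
    set e : ℝ := m - α + β with he
    refine ⟨A * (2 * Real.pi) ^ β * 4 ^ |e|, fun x ξ => ?_⟩
    have hpos : 0 ≤ A * (2 * Real.pi) ^ β * 4 ^ |e| * (1 + ‖ξ‖) ^ e := by positivity
    obtain ⟨k, hk⟩ := shiftSymbol_eventually_eq hu m ξ
    have heq : (fun ξ' => iteratedFDeriv ℝ β (fun x' => shiftSymbol u m x' ξ') x) =ᶠ[nhds ξ]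
        fun ξ' => cutoff u (((2:ℝ) ^ k)⁻¹ • ξ') • ((((2:ℝ) ^ k) ^ m : ℝ) •
          iteratedFDeriv ℝ β (modulation ((2:ℝ) ^ k • u)) x) := by
      filter_upwards [hk] with ξ' hξ'
      rw [← iteratedFDeriv_shiftPiece]
      congr 1
      funext x'
      exact hξ' x'
    rw [(Filter.EventuallyEq.iteratedFDeriv ℝ heq α).eq_of_nhds]
    set V := (((2:ℝ) ^ k) ^ m : ℝ) • iteratedFDeriv ℝ β (modulation ((2:ℝ) ^ k • u)) x with hV
    have hVn : ‖V‖ ≤ ((2:ℝ) ^ k) ^ m * (2 * Real.pi * 2 ^ k) ^ β := by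
      rw [hV, norm_smul, Real.norm_of_nonneg (by positivity)]
      refine mul_le_mul_of_nonneg_left ?_ (by positivity)
      refine (norm_iteratedFDeriv_modulation_le _ _ _).trans (le_of_eq ?_)
      rw [norm_smul, hu]; simp
    have hL := (ContinuousLinearMap.toSpanSingleton ℝ V).norm_iteratedFDeriv_comp_left
      (f := fun ξ' => cutoff u (((2:ℝ) ^ k)⁻¹ • ξ')) (x := ξ) (N := ∞) (n := α)
      (contDiff_cutoff_scale u _).contDiffAt (by exact_mod_cast le_top)
    have hcomp : (⇑(ContinuousLinearMap.toSpanSingleton ℝ V) ∘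
        fun ξ' => cutoff u (((2:ℝ) ^ k)⁻¹ • ξ')) =
        fun ξ' => cutoff u (((2:ℝ) ^ k)⁻¹ • ξ') • V := by
      funext ξ'; simp [ContinuousLinearMap.toSpanSingleton_apply]
    rw [hcomp, ContinuousLinearMap.norm_toSpanSingleton] at hL
    refine hL.trans ?_
    have hk0 : (0:ℝ) < 2 ^ k := by positivity
    have hscale : ‖iteratedFDeriv ℝ α (fun ξ' => cutoff u (((2:ℝ) ^ k)⁻¹ • ξ')) ξ‖ =
        (((2:ℝ) ^ k)⁻¹) ^ α * ‖iteratedFDeriv ℝ α (cutoff u) (((2:ℝ) ^ k)⁻¹ • ξ)‖ := by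
      have := iteratedFDeriv_comp_const_smul (𝕜 := ℝ) (i := α) (((2:ℝ) ^ k)⁻¹)
        ((cutoff u).contDiff)
      rw [this]
      rw [norm_smul, Real.norm_of_nonneg (by positivity)]
    rw [hscale]
    by_cases hz : iteratedFDeriv ℝ α (cutoff u) (((2:ℝ) ^ k)⁻¹ • ξ) = 0
    · rw [hz]; simpa using hpos
    · have hmem : ((2:ℝ) ^ k)⁻¹ • ξ ∈ Metric.closedBall u (1 / 4) := by
        have h1 : ((2:ℝ) ^ k)⁻¹ • ξ ∈ Function.support (iteratedFDeriv ℝ α (cutoff u)) := hz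
        have h2 := support_iteratedFDeriv_subset (𝕜 := ℝ) α h1
        rwa [(cutoff u).tsupport_eq] at h2
      rw [mem_closedBall_iff_norm] at hmem
      have h2 : ‖((2:ℝ) ^ k)⁻¹ • ξ‖ = (2 ^ k)⁻¹ * ‖ξ‖ := by
        rw [norm_smul]; simp
      have h3 := abs_le.1 ((abs_norm_sub_norm_le (((2:ℝ) ^ k)⁻¹ • ξ) u).trans hmem)
      rw [h2, hu] at h3
      have h5 : ‖ξ‖ = 2 ^ k * ((2 ^ k)⁻¹ * ‖ξ‖) := by field_simp
      have hk1 : (1:ℝ) ≤ 2 ^ k := one_le_pow₀ (by norm_num)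
      have hlo : (2:ℝ) ^ k ≤ 4 * (1 + ‖ξ‖) := by rw [h5]; nlinarith [h3.1]
      have hhi : 1 + ‖ξ‖ ≤ 4 * (2:ℝ) ^ k := by rw [h5]; nlinarith [h3.2]
      have hcmp := rpow_le_of_comparable hk0 (by positivity : (0:ℝ) < 1 + ‖ξ‖) hlo hhi e
      have hpw : ((2:ℝ) ^ k) ^ m * (2 * Real.pi * 2 ^ k) ^ β * (((2:ℝ) ^ k)⁻¹) ^ α =
          (2 * Real.pi) ^ β * ((2:ℝ) ^ k) ^ e := by
        rw [he, Real.rpow_add hk0, Real.rpow_sub hk0, Real.rpow_natCast, Real.rpow_natCast,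
          mul_pow _ _ β, inv_pow]
        field_simp
      calc ‖V‖ * (((2:ℝ) ^ k)⁻¹ ^ α * ‖iteratedFDeriv ℝ α (cutoff u) (((2:ℝ) ^ k)⁻¹ • ξ)‖)
          ≤ (((2:ℝ) ^ k) ^ m * (2 * Real.pi * 2 ^ k) ^ β) * (((2:ℝ) ^ k)⁻¹ ^ α * A) := by
            gcongr
            exact hA _
        _ = A * ((2 * Real.pi) ^ β * ((2:ℝ) ^ k) ^ e) := by rw [← hpw]; ring
        _ ≤ A * ((2 * Real.pi) ^ β * (4 ^ |e| * (1 + ‖ξ‖) ^ e)) := by gcongr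
        _ = _ := by ring

/-! ### Wave packets -/

/-- The plane wave `e^{2πi⟨x,ξ⟩}`. -/
def plane {d : ℕ} (x ξ : RD d) : ℂ :=
  Complex.exp (2 * Real.pi * Complex.I * ((⟪x, ξ⟫ : ℝ) : ℂ))

lemma norm_plane {d : ℕ} (x ξ : RD d) : ‖plane x ξ‖ = 1 := by
  simp [plane, Complex.norm_exp]

lemma plane_add_left {d : ℕ} (x y ξ : RD d) : plane (x + y) ξ = plane x ξ * plane y ξ := by
  rw [plane, plane, plane, ← Complex.exp_add, inner_add_left]
  congr 1; push_cast; ring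

lemma plane_add_right {d : ℕ} (x ξ η : RD d) : plane x (ξ + η) = plane x ξ * plane x η := by
  rw [plane, plane, plane, ← Complex.exp_add, inner_add_right]
  congr 1; push_cast; ring

lemma plane_sub_left {d : ℕ} (x y ξ : RD d) : plane (x - y) ξ = plane x ξ * plane (-y) ξ := by
  rw [sub_eq_add_neg, plane_add_left]

lemma plane_smul_left {d : ℕ} (c : ℝ) (x ξ : RD d) : plane (c • x) ξ = plane x (c • ξ) := by
  rw [plane, plane, real_inner_smul_left, real_inner_smul_right]

lemma plane_zero_left {d : ℕ} (ξ : RD d) : plane 0 ξ = 1 := by simp [plane]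

lemma plane_zero_right {d : ℕ} (x : RD d) : plane x 0 = 1 := by simp [plane]

lemma modulation_mul_plane {d : ℕ} (x v : RD d) : modulation v x * plane x v = 1 := by
  rw [modulation, plane, ← Complex.exp_add]; simp

lemma contDiff_plane_right {d : ℕ} (x : RD d) : ContDiff ℝ ∞ (fun ξ : RD d => plane x ξ) := by
  unfold plane
  have h : ContDiff ℝ ∞ (fun ξ : RD d => ((⟪x, ξ⟫ : ℝ) : ℂ)) :=
    Complex.ofRealCLM.contDiff.comp (contDiff_const.inner ℝ contDiff_id)
  exact (contDiff_const.mul h).cexp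

lemma continuous_plane {d : ℕ} : Continuous (fun p : RD d × RD d => plane p.1 p.2) := by
  unfold plane
  fun_prop

lemma fourierS_apply {d : ℕ} (f : 𝓢(RD d, ℂ)) (ξ : RD d) :
    fourierS f ξ = ∫ y, f y * plane (-y) ξ := by
  have : fourierS f ξ = FourierTransform.fourier (f : RD d → ℂ) ξ := rfl
  rw [this, Real.fourier_eq']
  refine integral_congr_ae (Eventually.of_forall fun y => ?_)
  simp only [plane, smul_eq_mul, inner_neg_left]
  rw [mul_comm]
  congr 2; push_cast; ring

lemma fourierInv_apply {d : ℕ} (f : 𝓢(RD d, ℂ)) (x : RD d) :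
    FourierTransformInv.fourierInv f x = ∫ ξ, f ξ * plane x ξ := by
  have : FourierTransformInv.fourierInv f x =
      FourierTransformInv.fourierInv (f : RD d → ℂ) x := by
    rw [SchwartzMap.fourierInv_coe]
  rw [this, Real.fourierInv_eq']
  refine integral_congr_ae (Eventually.of_forall fun y => ?_)
  simp only [plane, smul_eq_mul, real_inner_comm]
  rw [mul_comm]
  congr 2; push_cast; ring

lemma eq_integral_fourierS {d : ℕ} (f : 𝓢(RD d, ℂ)) (x : RD d) :
    f x = ∫ ξ, fourierS f ξ * plane x ξ := by
  have h : FourierTransformInv.fourierInv (fourierS f) = f := FourierTransform.fourierInv_fourier_eq f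
  rw [← fourierInv_apply, h]

/-- A smooth cutoff adapted to the origin. -/
def baseBump (d : ℕ) : ContDiffBump (0 : RD d) where
  rIn := 1 / 16
  rOut := 1 / 8
  rIn_pos := by norm_num
  rIn_lt_rOut := by norm_num

/-- Fourier transform of the wave packet at frequency `v`, scale `2^{-l}`, centred at `y`. -/
def packetHat {d : ℕ} (v : RD d) (l : ℕ) (y ξ : RD d) : ℂ :=
  baseBump d (((2:ℝ) ^ l)⁻¹ • (ξ - v)) • plane (-y) (ξ - v)

lemma packetHat_eq_zero {d : ℕ} {v : RD d} {l : ℕ} {y ξ : RD d}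
    (h : (2:ℝ) ^ l / 8 ≤ ‖ξ - v‖) : packetHat v l y ξ = 0 := by
  have hl : (0:ℝ) < 2 ^ l := by positivity
  have : baseBump d (((2:ℝ) ^ l)⁻¹ • (ξ - v)) = 0 := by
    apply ContDiffBump.zero_of_le_dist
    rw [dist_zero_right, norm_smul, norm_inv, Real.norm_of_nonneg hl.le]
    change (1:ℝ) / 8 ≤ _
    rw [inv_mul_eq_div, le_div_iff₀ hl]
    linarith
  rw [packetHat, this, zero_smul]

lemma packetHat_eq_plane {d : ℕ} {v : RD d} {l : ℕ} {y ξ : RD d}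
    (h : ‖ξ - v‖ ≤ (2:ℝ) ^ l / 16) : packetHat v l y ξ = plane (-y) (ξ - v) := by
  have hl : (0:ℝ) < 2 ^ l := by positivity
  have : baseBump d (((2:ℝ) ^ l)⁻¹ • (ξ - v)) = 1 := by
    apply ContDiffBump.one_of_mem_closedBall
    rw [mem_closedBall_zero_iff, norm_smul, norm_inv, Real.norm_of_nonneg hl.le]
    change _ ≤ (1:ℝ) / 16
    rw [inv_mul_eq_div, div_le_iff₀ hl]
    linarith
  rw [packetHat, this, one_smul]

lemma contDiff_packetHat {d : ℕ} (v : RD d) (l : ℕ) (y : RD d) :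
    ContDiff ℝ ∞ (packetHat v l y) := by
  unfold packetHat
  have h : ContDiff ℝ ∞ (fun ξ : RD d => ξ - v) := contDiff_id.sub contDiff_const
  exact ((baseBump d).contDiff.comp (h.const_smul _)).smul ((contDiff_plane_right _).comp h)

lemma hasCompactSupport_packetHat {d : ℕ} (v : RD d) (l : ℕ) (y : RD d) :
    HasCompactSupport (packetHat v l y) := by
  refine HasCompactSupport.of_support_subset_isCompact
    (isCompact_closedBall v ((2:ℝ) ^ l / 8)) fun ξ hξ => ?_
  rw [mem_closedBall_iff_norm]
  by_contra hlt
  exact hξ (packetHat_eq_zero (not_le.1 hlt).le)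

/-- The wave packet at frequency `v`, scale `2^{-l}`, centred at `y`. -/
def packet {d : ℕ} (v : RD d) (l : ℕ) (y : RD d) : 𝓢(RD d, ℂ) :=
  FourierTransformInv.fourierInv
    ((hasCompactSupport_packetHat v l y).toSchwartzMap (contDiff_packetHat v l y))

lemma fourierS_packet {d : ℕ} (v : RD d) (l : ℕ) (y ξ : RD d) :
    fourierS (packet v l y) ξ = packetHat v l y ξ := by
  have : fourierS (packet v l y) =
      (hasCompactSupport_packetHat v l y).toSchwartzMap (contDiff_packetHat v l y) := by
    have h (g : 𝓢(RD d, ℂ)) :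
        FourierTransform.fourier (FourierTransformInv.fourierInv g : 𝓢(RD d, ℂ)) = g :=
      FourierTransform.fourier_fourierInv_eq g
    exact h _
  rw [this]; rfl

lemma packet_apply {d : ℕ} (v : RD d) (l : ℕ) (y x : RD d) :
    packet v l y x = ∫ ξ, packetHat v l y ξ * plane x ξ := by
  rw [packet, fourierInv_apply]; rfl

lemma integrable_packetHat {d : ℕ} (v : RD d) (l : ℕ) (y : RD d) :
    Integrable (packetHat v l y) :=
  (contDiff_packetHat v l y).continuous.integrable_of_hasCompactSupport
    (hasCompactSupport_packetHat v l y)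

lemma integrable_packetHat_mul_plane {d : ℕ} (v : RD d) (l : ℕ) (y x : RD d) :
    Integrable (fun ξ => packetHat v l y ξ * plane x ξ) := by
  refine (integrable_packetHat v l y).mono ?_ (Eventually.of_forall fun ξ => ?_)
  · exact ((contDiff_packetHat v l y).continuous.mul
      (contDiff_plane_right x).continuous).aestronglyMeasurable
  · simp [norm_plane]

lemma packet_eq_plane_mul {d : ℕ} (v : RD d) (l : ℕ) (y x : RD d) :
    packet v l y x = plane x v * packet 0 l y x := by
  rw [packet_apply, packet_apply, ← integral_const_mul,
    ← integral_add_right_eq_self _ v]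
  refine integral_congr_ae (Eventually.of_forall fun ξ => ?_)
  simp only [packetHat, add_sub_cancel_right, sub_zero, plane_add_right]
  ring

lemma packet_zero_eq_scale {d : ℕ} (l : ℕ) (y x : RD d) :
    packet 0 l y x = (((2:ℝ) ^ l) ^ d : ℝ) * packet 0 0 0 ((2:ℝ) ^ l • (x - y)) := by
  have hl : (0:ℝ) < 2 ^ l := by positivity
  rw [packet_apply, packet_apply]
  have h := Measure.integral_comp_inv_smul_of_nonneg (volume : Measure (RD d))
    (fun ξ => packetHat 0 0 0 ξ * plane ((2:ℝ) ^ l • (x - y)) ξ) hl.le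
  rw [finrank_euclideanSpace_fin, Complex.real_smul] at h
  rw [← h]
  refine integral_congr_ae (Eventually.of_forall fun ξ => ?_)
  simp only [packetHat, sub_zero, pow_zero, inv_one, one_smul, neg_zero, plane_zero_left,
    plane_smul_left, smul_smul, mul_inv_cancel₀ hl.ne', plane_sub_left, Complex.real_smul]
  ring_nf

lemma norm_packet {d : ℕ} (v : RD d) (l : ℕ) (y x : RD d) :
    ‖packet v l y x‖ = ((2:ℝ) ^ l) ^ d * ‖packet 0 0 0 ((2:ℝ) ^ l • (x - y))‖ := by
  rw [packet_eq_plane_mul, packet_zero_eq_scale, norm_mul, norm_plane, one_mul, norm_mul,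
    Complex.norm_real, Real.norm_of_nonneg (by positivity)]

/-! ### Littlewood–Paley pieces of wave packets -/

lemma continuous_LPkernel {d : ℕ} (D : LPData d) (j : ℕ) : Continuous (LPkernel D j) := by
  cases j with
  | zero => exact D.Φ.continuous
  | succ j =>
    change Continuous fun x : RD d => _ * D.φ ((2:ℝ) ^ (j + 1) • x)
    exact continuous_const.mul (D.φ.continuous.comp (continuous_const_smul _))

lemma integrable_LPkernel {d : ℕ} (D : LPData d) (j : ℕ) : Integrable (LPkernel D j) := by
  cases j with
  | zero => exact D.Φ.integrable
  | succ j =>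
    change Integrable fun x : RD d => _ * D.φ ((2:ℝ) ^ (j + 1) • x)
    exact (D.φ.integrable.comp_smul (by positivity)).const_mul _

lemma LPhat_eq_integral {d : ℕ} (D : LPData d) (j : ℕ) (ξ : RD d) :
    LPhat D j ξ = ∫ y, LPkernel D j y * plane (-y) ξ := by
  cases j with
  | zero => exact fourierS_apply _ _
  | succ j =>
    have hl : (0:ℝ) < 2 ^ (j + 1) := by positivity
    change fourierS D.φ (((2:ℝ) ^ (j + 1))⁻¹ • ξ) =
      ∫ y, ((((2:ℝ) ^ ((j + 1) * d) : ℝ) : ℂ) * D.φ ((2:ℝ) ^ (j + 1) • y)) * plane (-y) ξ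
    have h := Measure.integral_comp_smul_of_nonneg (volume : Measure (RD d))
      (fun y => D.φ y * plane (-y) (((2:ℝ) ^ (j + 1))⁻¹ • ξ)) ((2:ℝ) ^ (j + 1)) (hR := hl.le)
    rw [← fourierS_apply, finrank_euclideanSpace_fin, ← pow_mul] at h
    have h2 : fourierS D.φ (((2:ℝ) ^ (j + 1))⁻¹ • ξ) = (2:ℝ) ^ ((j + 1) * d) •
        (((2:ℝ) ^ ((j + 1) * d))⁻¹ • fourierS D.φ (((2:ℝ) ^ (j + 1))⁻¹ • ξ)) := by
      rw [smul_smul, mul_inv_cancel₀ (by positivity), one_smul]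
    rw [h2, ← h, Complex.real_smul, ← integral_const_mul]
    refine integral_congr_ae (Eventually.of_forall fun y => ?_)
    simp only [← smul_neg, plane_smul_left, smul_smul, mul_inv_cancel₀ hl.ne', one_smul]
    ring

lemma LPkernel_eq_integral {d : ℕ} (D : LPData d) (j : ℕ) (x : RD d) :
    LPkernel D (j + 1) x = ∫ ξ, LPhat D (j + 1) ξ * plane x ξ := by
  have hl : (0:ℝ) < 2 ^ (j + 1) := by positivity
  change ((((2:ℝ) ^ ((j + 1) * d) : ℝ) : ℂ) * D.φ ((2:ℝ) ^ (j + 1) • x)) =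
    ∫ ξ, fourierS D.φ (((2:ℝ) ^ (j + 1))⁻¹ • ξ) * plane x ξ
  have h := Measure.integral_comp_inv_smul_of_nonneg (volume : Measure (RD d))
    (fun ξ => fourierS D.φ ξ * plane ((2:ℝ) ^ (j + 1) • x) ξ) hl.le
  rw [finrank_euclideanSpace_fin, ← eq_integral_fourierS, ← pow_mul, Complex.real_smul] at h
  rw [← h]
  refine integral_congr_ae (Eventually.of_forall fun ξ => ?_)
  simp only [plane_smul_left, smul_smul, mul_inv_cancel₀ hl.ne', one_smul]

lemma LP_packet {d : ℕ} (D : LPData d) (j : ℕ) (v : RD d) (l : ℕ) (y x : RD d) :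
    LP D j (packet v l y) x = ∫ ξ, LPhat D j ξ * packetHat v l y ξ * plane x ξ := by
  have hint : Integrable (Function.uncurry fun z ξ : RD d =>
      LPkernel D j z * (packetHat v l y ξ * plane (x - z) ξ)) (volume.prod volume) := by
    have h0 := (integrable_LPkernel D j).mul_prod (integrable_packetHat v l y)
    refine h0.mono ?_ (Eventually.of_forall fun p => ?_)
    · have : Continuous (Function.uncurry fun z ξ : RD d =>
          LPkernel D j z * (packetHat v l y ξ * plane (x - z) ξ)) :=
        ((continuous_LPkernel D j).comp continuous_fst).mul
          (((contDiff_packetHat v l y).continuous.comp continuous_snd).mul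
            (continuous_plane.comp ((continuous_const.sub continuous_fst).prodMk continuous_snd)))
      exact this.aestronglyMeasurable
    · simp [Function.uncurry, norm_plane]
  have h1 : LP D j (packet v l y) x =
      ∫ z, ∫ ξ, LPkernel D j z * (packetHat v l y ξ * plane (x - z) ξ) := by
    rw [LP]
    refine integral_congr_ae (Eventually.of_forall fun z => ?_)
    simp only
    rw [packet_apply, ← integral_const_mul]
  rw [h1, integral_integral_swap hint]
  refine integral_congr_ae (Eventually.of_forall fun ξ => ?_)
  simp only
  rw [LPhat_eq_integral, mul_assoc, ← integral_mul_const]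
  refine integral_congr_ae (Eventually.of_forall fun z => ?_)
  simp only [plane_sub_left]
  ring

lemma LPhat_succ_ne_zero {d : ℕ} {D : LPData d} {j : ℕ} {ξ : RD d}
    (h : LPhat D (j + 1) ξ ≠ 0) : (2:ℝ) ^ j ≤ ‖ξ‖ ∧ ‖ξ‖ ≤ (2:ℝ) ^ (j + 2) := by
  have hl : (0:ℝ) < 2 ^ (j + 1) := by positivity
  have := D.supp_φ _ h
  rw [norm_smul, norm_inv, Real.norm_of_nonneg hl.le, inv_mul_eq_div, le_div_iff₀ hl,
    div_le_iff₀ hl] at this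
  constructor
  · calc (2:ℝ) ^ j = 1 / 2 * 2 ^ (j + 1) := by ring
      _ ≤ _ := this.1
  · calc _ ≤ _ := this.2
      _ = _ := by ring

lemma LPhat_zero_eq_one {d : ℕ} (D : LPData d) {ξ : RD d} (h : ‖ξ‖ < 1) : LPhat D 0 ξ = 1 := by
  change fourierS D.Φ ξ = 1
  have h0 : ∀ k : ℕ, fourierS D.φ (((2:ℝ) ^ (k + 1))⁻¹ • ξ) = 0 := by
    intro k
    by_contra hne
    have := (LPhat_succ_ne_zero (D := D) (j := k) hne).1
    linarith [one_le_pow₀ (n := k) (one_le_two (α := ℝ))]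
  rw [D.Φ_def]; simp [h0]

lemma LPhat_zero_eq_zero {d : ℕ} (D : LPData d) {ξ : RD d} (h : 2 < ‖ξ‖) : LPhat D 0 ξ = 0 := by
  change fourierS D.Φ ξ = 0
  have hξ : ξ ≠ 0 := by rintro rfl; simp at h; linarith
  have hinj : Function.Injective fun k : ℕ => (k : ℤ) + 1 := by
    intro a b hab; simpa using hab
  have hs := (hinj.hasSum_iff (f := fun k : ℤ => fourierS D.φ ((2:ℝ) ^ (-k) • ξ)) (a := 1) ?_).2
    (D.sum_φ ξ hξ)
  · rw [D.Φ_def, sub_eq_zero, ← hs.tsum_eq]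
    refine tsum_congr fun k => ?_
    simp only [Function.comp]
    rw [zpow_neg]; norm_cast
  · intro k hk
    have hk0 : k ≤ 0 := by
      by_contra hlt
      exact hk ⟨(k - 1).toNat, by simp; omega⟩
    by_contra hne
    have h1 := (D.supp_φ _ hne).2
    rw [norm_smul, Real.norm_of_nonneg (by positivity)] at h1
    have : (1:ℝ) ≤ 2 ^ (-k) := one_le_zpow₀ one_le_two (by omega)
    nlinarith [norm_nonneg ξ]

lemma norm_of_packetHat_ne_zero {d : ℕ} {u : RD d} (hu : ‖u‖ = 1) {k l : ℕ} (hlk : l ≤ k)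
    {y ξ : RD d} (h : packetHat ((2:ℝ) ^ k • u) l y ξ ≠ 0) :
    ‖ξ - (2:ℝ) ^ k • u‖ < 2 ^ k / 8 ∧ 7 / 8 * (2:ℝ) ^ k < ‖ξ‖ ∧ ‖ξ‖ < 9 / 8 * 2 ^ k := by
  have h1 : ‖ξ - (2:ℝ) ^ k • u‖ < 2 ^ l / 8 := by
    by_contra hlt; exact h (packetHat_eq_zero (not_lt.1 hlt))
  have h2 : (2:ℝ) ^ l ≤ 2 ^ k := pow_le_pow_right₀ one_le_two hlk
  have h3 : ‖(2:ℝ) ^ k • u‖ = 2 ^ k := by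
    rw [norm_smul, hu, mul_one, Real.norm_of_nonneg (by positivity)]
  have h4 := norm_sub_norm_le ((2:ℝ) ^ k • u) ξ
  have h5 := norm_sub_norm_le ξ ((2:ℝ) ^ k • u)
  rw [norm_sub_rev] at h4
  refine ⟨by linarith, by linarith, by linarith⟩

lemma LP_zero_packet_eq_zero {d : ℕ} (D : LPData d) {u : RD d} (hu : ‖u‖ = 1) {k l : ℕ}
    (hlk : l ≤ k) (hk : 3 ≤ k) (y x : RD d) :
    LP D 0 (packet ((2:ℝ) ^ k • u) l y) x = 0 := by
  rw [LP_packet]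
  refine integral_eq_zero_of_ae (Eventually.of_forall fun ξ => ?_)
  by_cases h : packetHat ((2:ℝ) ^ k • u) l y ξ = 0
  · simp [h]
  · have h1 := (norm_of_packetHat_ne_zero hu hlk h).2.1
    have h2 : (2:ℝ) ^ 3 ≤ 2 ^ k := pow_le_pow_right₀ one_le_two hk
    simp [LPhat_zero_eq_zero D (ξ := ξ) (by linarith)]

lemma LP_packet_eq_zero {d : ℕ} (D : LPData d) {u : RD d} (hu : ‖u‖ = 1) {j k l : ℕ}
    (hlk : l ≤ k) (hj : ¬ (k ≤ j + 2 ∧ j ≤ k)) (y x : RD d) :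
    LP D (j + 1) (packet ((2:ℝ) ^ k • u) l y) x = 0 := by
  rw [LP_packet]
  refine integral_eq_zero_of_ae (Eventually.of_forall fun ξ => ?_)
  by_cases h : packetHat ((2:ℝ) ^ k • u) l y ξ = 0
  · simp [h]
  have h1 := (norm_of_packetHat_ne_zero hu hlk h).2
  suffices LPhat D (j + 1) ξ = 0 by simp [this]
  by_contra hne
  have h2 := LPhat_succ_ne_zero hne
  have hk0 : (0:ℝ) < 2 ^ k := by positivity
  refine hj ⟨?_, ?_⟩
  · by_contra hlt
    have : (2:ℝ) ^ (j + 3) ≤ 2 ^ k := pow_le_pow_right₀ one_le_two (by omega)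
    have h3 : (2:ℝ) ^ (j + 3) = 2 * 2 ^ (j + 2) := by ring
    linarith
  · by_contra hlt
    have : (2:ℝ) ^ (k + 1) ≤ 2 ^ j := pow_le_pow_right₀ one_le_two (by omega)
    have h3 : (2:ℝ) ^ (k + 1) = 2 * 2 ^ k := by ring
    linarith

lemma LP_zero_packet_zero {d : ℕ} (D : LPData d) (x : RD d) :
    LP D 0 (packet 0 0 0) x = packet 0 0 0 x := by
  rw [LP_packet, packet_apply]
  refine integral_congr_ae (Eventually.of_forall fun ξ => ?_)
  by_cases h : packetHat 0 0 0 ξ = 0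
  · simp [h]
  have : ‖ξ‖ < 1 := by
    by_contra hlt
    exact h (packetHat_eq_zero (by rw [sub_zero, pow_zero]; linarith))
  simp [LPhat_zero_eq_one D this]

lemma LP_packet_zero_eq_kernel {d : ℕ} (D : LPData d) {j l : ℕ} (h : j + 6 ≤ l) (y x : RD d) :
    LP D (j + 1) (packet 0 l y) x = LPkernel D (j + 1) (x - y) := by
  rw [LP_packet, LPkernel_eq_integral]
  refine integral_congr_ae (Eventually.of_forall fun ξ => ?_)
  simp only
  by_cases h0 : LPhat D (j + 1) ξ = 0
  · simp [h0]
  have h1 := (LPhat_succ_ne_zero h0).2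
  have h2 : (2:ℝ) ^ (j + 6) ≤ 2 ^ l := pow_le_pow_right₀ one_le_two h
  have h3 : (2:ℝ) ^ (j + 6) = 16 * 2 ^ (j + 2) := by ring
  rw [packetHat_eq_plane (by rw [sub_zero]; linarith), sub_zero, plane_sub_left]
  ring

lemma shiftSymbol_mul_packetHat {d : ℕ} {u : RD d} (hu : ‖u‖ = 1) (m : ℝ) {k l : ℕ} (hlk : l ≤ k)
    (y x ξ : RD d) :
    shiftSymbol u m x ξ * packetHat ((2:ℝ) ^ k • u) l y ξ =
      (((2:ℝ) ^ k) ^ m : ℝ) * modulation ((2:ℝ) ^ k • u) x * packetHat ((2:ℝ) ^ k • u) l y ξ := by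
  by_cases h : packetHat ((2:ℝ) ^ k • u) l y ξ = 0
  · simp [h]
  obtain ⟨ha, hb, hc⟩ := norm_of_packetHat_ne_zero hu hlk h
  have hk0 : (0:ℝ) < 2 ^ k := by positivity
  congr 1
  rw [shiftSymbol, tsum_eq_single k]
  · have : cutoff u (((2:ℝ) ^ k)⁻¹ • ξ) = 1 := by
      apply ContDiffBump.one_of_mem_closedBall
      rw [mem_closedBall_iff_norm]
      have : ((2:ℝ) ^ k)⁻¹ • ξ - u = ((2:ℝ) ^ k)⁻¹ • (ξ - (2:ℝ) ^ k • u) := by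
        rw [smul_sub, smul_smul, inv_mul_cancel₀ hk0.ne', one_smul]
      rw [this, norm_smul, norm_inv, Real.norm_of_nonneg hk0.le]
      change _ ≤ (1:ℝ) / 8
      rw [inv_mul_eq_div, div_le_iff₀ hk0]
      linarith
    rw [shiftPiece, this, one_smul]
  · intro k' hk'
    rw [shiftPiece, cutoff_scale_unique hu (k₀ := k) (Or.inr (by linarith)) (by linarith) hk',
      zero_smul]

lemma fourierS_sum {d : ℕ} {ι : Type*} (S : Finset ι) (c : ι → ℂ) (g : ι → 𝓢(RD d, ℂ)) (ξ : RD d) :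
    fourierS (∑ t ∈ S, c t • g t) ξ = ∑ t ∈ S, c t * fourierS (g t) ξ := by
  have : fourierS (∑ t ∈ S, c t • g t) = ∑ t ∈ S, c t • fourierS (g t) := by
    simp only [fourierS, map_sum, map_smul]
  rw [this, sum_apply]
  simp

lemma pdo_sum_packet {d : ℕ} {u : RD d} (hu : ‖u‖ = 1) (m : ℝ) {ι : Type*} (S : Finset ι)
    (c : ι → ℂ) (k l : ι → ℕ) (y : ι → RD d) (hlk : ∀ t ∈ S, l t ≤ k t) :
    pdo (shiftSymbol u m) (∑ t ∈ S, c t • packet ((2:ℝ) ^ k t • u) (l t) (y t)) =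
      ⇑(∑ t ∈ S, (c t * (((2:ℝ) ^ k t) ^ m : ℝ)) • packet 0 (l t) (y t)) := by
  funext x
  rw [sum_apply]
  have h0 : ∀ t, packet 0 (l t) (y t) x = modulation ((2:ℝ) ^ k t • u) x *
      ∫ ξ, packetHat ((2:ℝ) ^ k t • u) (l t) (y t) ξ * plane x ξ := by
    intro t
    rw [← packet_apply, packet_eq_plane_mul ((2:ℝ) ^ k t • u), ← mul_assoc, modulation_mul_plane, one_mul]
  have h1 : ∀ t ∈ S, (c t * (((2:ℝ) ^ k t) ^ m : ℝ)) • packet 0 (l t) (y t) x =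
      ∫ ξ, c t * (((2:ℝ) ^ k t) ^ m : ℝ) * modulation ((2:ℝ) ^ k t • u) x *
        (packetHat ((2:ℝ) ^ k t • u) (l t) (y t) ξ * plane x ξ) := by
    intro t _
    rw [h0, integral_const_mul, smul_eq_mul]; ring
  simp only [smul_apply]
  rw [Finset.sum_congr rfl h1, ← integral_finsetSum, pdo]
  · refine integral_congr_ae (Eventually.of_forall fun ξ => ?_)
    change _ * fourierS _ ξ * plane x ξ = _
    simp only
    rw [fourierS_sum, Finset.mul_sum, Finset.sum_mul]
    refine Finset.sum_congr rfl fun t ht => ?_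
    rw [fourierS_packet]
    linear_combination c t * plane x ξ * shiftSymbol_mul_packetHat hu m (hlk t ht) (y t) x ξ
  · intro t _
    exact (integrable_packetHat_mul_plane _ _ _ _).const_mul _

lemma exists_schwartz_decay {d : ℕ} (g : 𝓢(RD d, ℂ)) (K : ℕ) :
    ∃ C : ℝ, 0 ≤ C ∧ ∀ z, ‖g z‖ * (1 + ‖z‖) ^ K ≤ C := by
  have h := fun z => SchwartzMap.one_add_le_sup_seminorm_apply (𝕜 := ℂ) (m := (K, 0)) le_rfl
    le_rfl g z
  simp only [norm_iteratedFDeriv_zero] at h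
  refine ⟨_, le_trans (by positivity) (h 0), fun z => ?_⟩
  rw [mul_comm]; exact h z

lemma integrable_LPkernel_mul {d : ℕ} (D : LPData d) (j : ℕ) (g : 𝓢(RD d, ℂ)) (x : RD d) :
    Integrable fun z => LPkernel D j z * g (x - z) := by
  obtain ⟨C, -, hC⟩ := exists_schwartz_decay g 0
  refine (integrable_LPkernel D j).mul_bdd (c := C) ?_ (Eventually.of_forall fun z => ?_)
  · exact (g.continuous.comp (continuous_const.sub continuous_id)).aestronglyMeasurable
  · simpa using hC (x - z)

lemma LP_sum {d : ℕ} (D : LPData d) (j : ℕ) {ι : Type*} (S : Finset ι) (c : ι → ℂ)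
    (g : ι → 𝓢(RD d, ℂ)) (x : RD d) :
    LP D j (⇑(∑ t ∈ S, c t • g t)) x = ∑ t ∈ S, c t * LP D j (g t) x := by
  have h : ∀ t, c t * LP D j (g t) x = ∫ z, c t * (LPkernel D j z * g t (x - z)) := fun t => by
    rw [LP, integral_const_mul]
  simp only [h]
  rw [← integral_finsetSum _ fun t _ => (integrable_LPkernel_mul D j (g t) x).const_mul _, LP]
  refine integral_congr_ae (Eventually.of_forall fun z => ?_)
  simp only [sum_apply, smul_apply, smul_eq_mul, Finset.mul_sum]
  exact Finset.sum_congr rfl fun t _ => by ring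

lemma measurable_LP {d : ℕ} (D : LPData d) (j : ℕ) (g : 𝓢(RD d, ℂ)) : Measurable (LP D j g) := by
  have hc : Continuous fun p : RD d × RD d => LPkernel D j p.2 * g (p.1 - p.2) :=
    ((continuous_LPkernel D j).comp continuous_snd).mul
      (g.continuous.comp (continuous_fst.sub continuous_snd))
  exact (hc.stronglyMeasurable.integral_prod_right' (ν := volume)).measurable

lemma integrable_schwartz_weight {d : ℕ} (g : 𝓢(RD d, ℂ)) (K : ℕ) :
    Integrable fun z => ‖g z‖ * (1 + ‖z‖) ^ K := by
  have h1 := (g.integrable_pow_mul volume K).const_mul ((2:ℝ) ^ K)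
  have h2 := (g.integrable_pow_mul volume 0).const_mul ((2:ℝ) ^ K)
  refine (h1.add h2).mono' ?_ (Eventually.of_forall fun z => ?_)
  · exact (by fun_prop : Continuous fun z => ‖g z‖ * (1 + ‖z‖) ^ K).aestronglyMeasurable
  · rw [Real.norm_of_nonneg (by positivity)]
    have h3 : (1 + ‖z‖) ^ K ≤ 2 ^ K * (‖z‖ ^ K + ‖z‖ ^ 0) := by
      rcases le_total ‖z‖ 1 with h | h
      · calc (1 + ‖z‖) ^ K ≤ 2 ^ K * 1 := by
              rw [mul_one]; exact pow_le_pow_left₀ (by positivity) (by linarith) K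
          _ ≤ _ := by gcongr; simp
      · calc (1 + ‖z‖) ^ K ≤ (2 * ‖z‖) ^ K := pow_le_pow_left₀ (by positivity) (by linarith) K
          _ = 2 ^ K * (‖z‖ ^ K + 0) := by rw [mul_pow, add_zero]
          _ ≤ _ := by gcongr; positivity
    calc _ ≤ ‖g z‖ * (2 ^ K * (‖z‖ ^ K + ‖z‖ ^ 0)) := by gcongr
      _ = _ := by simp only [Pi.add_apply]; ring

lemma exists_LP_packet_decay {d : ℕ} (D : LPData d) (K : ℕ) :
    ∃ C : ℝ, 0 ≤ C ∧ ∀ (v : RD d) (j l : ℕ) (y x : RD d), l ≤ j + 2 →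
      ‖LP D (j + 1) (packet v l y) x‖ * (1 + 2 ^ l * ‖x - y‖) ^ K ≤ C * ((2:ℝ) ^ l) ^ d := by
  obtain ⟨C₁, hC₁, hdec⟩ := exists_schwartz_decay (packet (0 : RD d) 0 0) K
  set I := ∫ z, ‖D.φ z‖ * (1 + ‖z‖) ^ K with hI
  have hI0 : 0 ≤ I := integral_nonneg fun z => by positivity
  refine ⟨C₁ * 2 ^ K * I, by positivity, fun v j l y x hlj => ?_⟩
  have hj : (0:ℝ) < 2 ^ (j + 1) := by positivity
  have hl : (0:ℝ) < 2 ^ l := by positivity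
  have hlj' : (2:ℝ) ^ l ≤ 2 * 2 ^ (j + 1) := by
    calc (2:ℝ) ^ l ≤ 2 ^ (j + 2) := pow_le_pow_right₀ one_le_two hlj
      _ = _ := by ring
  have hscale : ∫ z, (2:ℝ) ^ ((j + 1) * d) *
      (‖D.φ ((2:ℝ) ^ (j + 1) • z)‖ * (1 + ‖(2:ℝ) ^ (j + 1) • z‖) ^ K) = I := by
    rw [integral_const_mul, Measure.integral_comp_smul_of_nonneg volume
      (fun z => ‖D.φ z‖ * (1 + ‖z‖) ^ K) _ (hR := hj.le), finrank_euclideanSpace_fin, ← pow_mul,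
      smul_eq_mul, ← mul_assoc, mul_inv_cancel₀ (by positivity), one_mul]
  have hint : Integrable fun z : RD d => (2:ℝ) ^ ((j + 1) * d) *
      (‖D.φ ((2:ℝ) ^ (j + 1) • z)‖ * (1 + ‖(2:ℝ) ^ (j + 1) • z‖) ^ K) :=
    ((integrable_schwartz_weight D.φ K).comp_smul hj.ne').const_mul _
  rw [LP, mul_comm, ← Real.norm_of_nonneg (by positivity : 0 ≤ (1 + 2 ^ l * ‖x - y‖) ^ K),
    ← Complex.norm_real, ← norm_mul, ← integral_const_mul]
  calc _ ≤ ∫ z, C₁ * 2 ^ K * ((2:ℝ) ^ l) ^ d * ((2:ℝ) ^ ((j + 1) * d) *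
      (‖D.φ ((2:ℝ) ^ (j + 1) • z)‖ * (1 + ‖(2:ℝ) ^ (j + 1) • z‖) ^ K)) := by
        refine norm_integral_le_of_norm_le (hint.const_mul _) (Eventually.of_forall fun z => ?_)
        have hw : 1 + 2 ^ l * ‖x - y‖ ≤
            (1 + ‖(2:ℝ) ^ l • (x - z - y)‖) * (2 * (1 + ‖(2:ℝ) ^ (j + 1) • z‖)) := by
          rw [norm_smul, norm_smul, Real.norm_of_nonneg hl.le, Real.norm_of_nonneg hj.le]
          have h1 : ‖x - y‖ ≤ ‖x - z - y‖ + ‖z‖ := by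
            calc ‖x - y‖ = ‖(x - z - y) + z‖ := by congr 1; abel
              _ ≤ _ := norm_add_le _ _
          have h2 : 2 ^ l * ‖x - y‖ ≤ 2 ^ l * ‖x - z - y‖ + 2 * 2 ^ (j + 1) * ‖z‖ := by
            calc 2 ^ l * ‖x - y‖ ≤ 2 ^ l * (‖x - z - y‖ + ‖z‖) := by gcongr
              _ = 2 ^ l * ‖x - z - y‖ + 2 ^ l * ‖z‖ := by ring
              _ ≤ _ := by gcongr
          have h3 : 0 ≤ 2 ^ l * ‖x - z - y‖ := by positivity
          have h4 : 0 ≤ 2 ^ (j + 1) * ‖z‖ := by positivity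
          nlinarith [mul_nonneg h3 h4]
        have hw' := pow_le_pow_left₀ (by positivity) hw K
        have hd := hdec ((2:ℝ) ^ l • (x - z - y))
        change ‖_ * ((_ * D.φ _) * _)‖ ≤ _
        rw [norm_mul, norm_mul, norm_mul, norm_packet, Complex.norm_real, Complex.norm_real,
          Real.norm_of_nonneg (by positivity), Real.norm_of_nonneg (by positivity)]
        set P := ‖packet (0 : RD d) 0 0 ((2:ℝ) ^ l • (x - z - y))‖
        set W := (1 + ‖(2:ℝ) ^ l • (x - z - y)‖)
        set V := (1 + ‖(2:ℝ) ^ (j + 1) • z‖)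
        calc _ ≤ (W * (2 * V)) ^ K * ((2:ℝ) ^ ((j + 1) * d) * ‖D.φ ((2:ℝ) ^ (j + 1) • z)‖ *
              (((2:ℝ) ^ l) ^ d * P)) := by gcongr
          _ = (P * W ^ K) * (2 ^ K * ((2:ℝ) ^ l) ^ d * ((2:ℝ) ^ ((j + 1) * d) *
              (‖D.φ ((2:ℝ) ^ (j + 1) • z)‖ * V ^ K))) := by
                rw [mul_pow, mul_pow]; ring
          _ ≤ C₁ * (2 ^ K * ((2:ℝ) ^ l) ^ d * ((2:ℝ) ^ ((j + 1) * d) *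
              (‖D.φ ((2:ℝ) ^ (j + 1) • z)‖ * V ^ K))) := by gcongr
          _ = _ := by ring
    _ = C₁ * 2 ^ K * I * ((2:ℝ) ^ l) ^ d := by
        rw [integral_const_mul, hscale]; ring

/-! ### Triebel–Lizorkin norms -/

/-- The `ℓ^q` quasi-norm of a sequence, `0 < q ≤ ∞`. -/
def ellNorm (q : ℝ≥0∞) (A : ℕ → ℝ≥0∞) : ℝ≥0∞ :=
  if q = (⊤ : ℝ≥0∞) then ⨆ k, A k else (∑' k, A k ^ q.toReal) ^ (1 / q.toReal)

/-- The weighted Littlewood–Paley piece `2^{s(k+1)} |Π_{k+1} g(x)|`. -/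
def lpTerm {d : ℕ} (D : LPData d) (s : ℝ) (g : RD d → ℂ) (k : ℕ) (x : RD d) : ℝ≥0∞ :=
  ENNReal.ofReal ((2:ℝ) ^ (s * ((k:ℝ) + 1)) * ‖LP D (k + 1) g x‖)

lemma two_rpow_mul_nnnorm (r : ℝ) (z : ℂ) :
    (2:ℝ≥0∞) ^ r * (‖z‖₊ : ℝ≥0∞) = ENNReal.ofReal ((2:ℝ) ^ r * ‖z‖) := by
  rw [ENNReal.ofReal_mul (by positivity), ← ENNReal.ofReal_rpow_of_pos two_pos, ofReal_norm,
    enorm_eq_nnnorm]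
  simp

lemma TLNorm_eq {d : ℕ} (D : LPData d) (s : ℝ) {p : ℝ≥0∞} (q : ℝ≥0∞) (hp : p ≠ ⊤)
    (g : RD d → ℂ) :
    TLNorm D s p q g = lpNormFun d p (LP D 0 g) +
      (∫⁻ x, ellNorm q (fun k => lpTerm D s g k x) ^ p.toReal) ^ (1 / p.toReal) := by
  simp only [TLNorm, if_neg hp, ellNorm, lpTerm, two_rpow_mul_nnnorm]
  split_ifs <;> rfl

lemma lpNormFun_zero (d : ℕ) {p : ℝ≥0∞} (hp0 : p ≠ 0) (hp : p ≠ ⊤) {g : RD d → ℂ}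
    (hg : ∀ x, g x = 0) : lpNormFun d p g = 0 := by
  have : 0 < p.toReal := ENNReal.toReal_pos hp0 hp
  simp [lpNormFun, hp, hg, this]

lemma le_ellNorm {q : ℝ≥0∞} (hq : q ≠ 0) (A : ℕ → ℝ≥0∞) (k : ℕ) : A k ≤ ellNorm q A := by
  unfold ellNorm
  split_ifs with h
  · exact le_iSup A k
  · have hq' : 0 < q.toReal := ENNReal.toReal_pos hq h
    calc A k = (A k ^ q.toReal) ^ (1 / q.toReal) := by
          rw [← ENNReal.rpow_mul, mul_one_div_cancel hq'.ne', ENNReal.rpow_one]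
      _ ≤ _ := ENNReal.rpow_le_rpow (ENNReal.le_tsum k) (by positivity)

lemma ellNorm_le_of_support {q : ℝ≥0∞} (hq : q ≠ 0) {A : ℕ → ℝ≥0∞} {B : ℝ≥0∞} (S : Finset ℕ)
    (h0 : ∀ k ∉ S, A k = 0) (hB : ∀ k, A k ≤ B) :
    ellNorm q A ≤ (S.card : ℝ≥0∞) ^ (1 / q.toReal) * B := by
  unfold ellNorm
  split_ifs with h
  · simpa [h] using hB
  · have hq' : 0 < q.toReal := ENNReal.toReal_pos hq h
    rw [tsum_eq_sum (s := S) fun k hk => by rw [h0 k hk, ENNReal.zero_rpow_of_pos hq']]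
    calc _ ≤ (S.card • B ^ q.toReal) ^ (1 / q.toReal) :=
          ENNReal.rpow_le_rpow (Finset.sum_le_card_nsmul _ _ _ fun k _ =>
            ENNReal.rpow_le_rpow (hB k) hq'.le) (by positivity)
      _ = _ := by
        rw [nsmul_eq_mul, ENNReal.mul_rpow_of_nonneg _ _ (by positivity), ← ENNReal.rpow_mul,
          mul_one_div_cancel hq'.ne', ENNReal.rpow_one]

lemma measurable_lpTerm {d : ℕ} (D : LPData d) (s : ℝ) (g : 𝓢(RD d, ℂ)) (k : ℕ) :
    Measurable (lpTerm D s g k) :=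
  ((measurable_LP D (k + 1) g).norm.const_mul _).ennreal_ofReal

/-! ### Decaying weights -/

/-- The weight `(1 + 2^l |x - y|)^{-a}`. -/
def decayWeight {d : ℕ} (a : ℝ) (l : ℕ) (y x : RD d) : ℝ := (1 + 2 ^ l * ‖x - y‖) ^ (-a)

lemma decayWeight_nonneg {d : ℕ} (a : ℝ) (l : ℕ) (y x : RD d) : 0 ≤ decayWeight a l y x := by
  unfold decayWeight; positivity

lemma decayWeight_le_one {d : ℕ} {a : ℝ} (ha : 0 ≤ a) (l : ℕ) (y x : RD d) :
    decayWeight a l y x ≤ 1 :=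
  Real.rpow_le_one_of_one_le_of_nonpos (by simp) (by linarith)

lemma decayWeight_comm {d : ℕ} (a : ℝ) (l : ℕ) (y x : RD d) :
    decayWeight a l y x = decayWeight a l x y := by
  rw [decayWeight, decayWeight, norm_sub_rev]

lemma continuous_decayWeight {d : ℕ} (a : ℝ) (l : ℕ) :
    Continuous fun z : RD d × RD d => decayWeight a l z.1 z.2 := by
  unfold decayWeight
  refine Continuous.rpow_const (by fun_prop) fun z => Or.inl (by positivity)

lemma decayWeight_rpow {d : ℕ} (a b : ℝ) (l : ℕ) (y x : RD d) :
    decayWeight a l y x ^ b = decayWeight (a * b) l y x := by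
  rw [decayWeight, decayWeight, ← Real.rpow_mul (by positivity)]; ring_nf

lemma lintegral_comp_smul_sub {d : ℕ} (F : RD d → ℝ≥0∞) (l : ℕ) (y : RD d) :
    ∫⁻ x, F ((2:ℝ) ^ l • (x - y)) = ENNReal.ofReal (((2:ℝ) ^ l) ^ d)⁻¹ * ∫⁻ x, F x := by
  have hl : (2:ℝ) ^ l ≠ 0 := by positivity
  rw [lintegral_sub_right_eq_self (fun x => F ((2:ℝ) ^ l • x)) y]
  have h := lintegral_map_equiv (μ := (volume : Measure (RD d))) F
    (Homeomorph.smulOfNeZero ((2:ℝ) ^ l) hl).toMeasurableEquiv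
  have h2 : Measure.map (Homeomorph.smulOfNeZero (α := RD d) ((2:ℝ) ^ l) hl).toMeasurableEquiv
      volume = ENNReal.ofReal (((2:ℝ) ^ l) ^ d)⁻¹ • volume := by
    have := Measure.map_addHaar_smul (volume : Measure (RD d)) hl
    rw [finrank_euclideanSpace_fin, abs_of_nonneg (by positivity)] at this
    exact this
  rw [h2, lintegral_smul_measure, smul_eq_mul] at h
  rw [h]; rfl

lemma lintegral_decayWeight {d : ℕ} (a : ℝ) (l : ℕ) (y : RD d) :
    ∫⁻ x, ENNReal.ofReal (decayWeight a l y x) =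
      ENNReal.ofReal (((2:ℝ) ^ l) ^ d)⁻¹ * ∫⁻ x : RD d, ENNReal.ofReal ((1 + ‖x‖) ^ (-a)) := by
  rw [← lintegral_comp_smul_sub (fun x => ENNReal.ofReal ((1 + ‖x‖) ^ (-a))) l y]
  simp [decayWeight, norm_smul]

lemma lintegral_one_add_norm_lt_top {d : ℕ} {a : ℝ} (ha : (d:ℝ) < a) :
    ∫⁻ x : RD d, ENNReal.ofReal ((1 + ‖x‖) ^ (-a)) < ⊤ :=
  finite_integral_one_add_norm (by rwa [finrank_euclideanSpace_fin])

/-- Littlewood–Paley pieces of a wave packet are localised in space and frequency. -/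
lemma exists_packet_term_bound {d : ℕ} (D : LPData d) (σ : ℝ) (K : ℕ) :
    ∃ C : ℝ, 0 ≤ C ∧ ∀ (u : RD d), ‖u‖ = 1 → ∀ (k l j : ℕ) (y x : RD d), l ≤ k →
      (2:ℝ) ^ (σ * ((j:ℝ) + 1)) * ‖LP D (j + 1) (packet ((2:ℝ) ^ k • u) l y) x‖ ≤
        C * (2:ℝ) ^ (σ * k + l * d) * decayWeight K l y x := by
  obtain ⟨C, hC, h⟩ := exists_LP_packet_decay D K
  refine ⟨2 ^ |σ| * C, by positivity, fun u hu k l j y x hlk => ?_⟩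
  have hw := decayWeight_nonneg K l y x
  by_cases hj : k ≤ j + 2 ∧ j ≤ k
  · have h1 := h ((2:ℝ) ^ k • u) j l y x (by omega)
    have h2 : ‖LP D (j + 1) (packet ((2:ℝ) ^ k • u) l y) x‖ ≤
        C * ((2:ℝ) ^ l) ^ d * decayWeight K l y x := by
      rw [decayWeight, Real.rpow_neg (by positivity), Real.rpow_natCast, ← div_eq_mul_inv,
        le_div_iff₀ (by positivity)]
      exact h1
    have h3 : (2:ℝ) ^ (σ * ((j:ℝ) + 1)) ≤ 2 ^ |σ| * 2 ^ (σ * k) := by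
      rw [← Real.rpow_add two_pos]
      apply Real.rpow_le_rpow_of_exponent_le one_le_two
      have h4 : |(j:ℝ) + 1 - k| ≤ 1 := by
        have h5 : (k:ℝ) ≤ j + 2 := by exact_mod_cast hj.1
        have h6 : (j:ℝ) ≤ k := by exact_mod_cast hj.2
        rw [abs_le]; constructor <;> linarith
      have h7 : σ * ((j:ℝ) + 1 - k) ≤ |σ| := by
        calc _ ≤ |σ * ((j:ℝ) + 1 - k)| := le_abs_self _
          _ = |σ| * |(j:ℝ) + 1 - k| := abs_mul _ _
          _ ≤ |σ| * 1 := by gcongr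
          _ = _ := mul_one _
      linarith
    have h8 : (2:ℝ) ^ (σ * k + l * d) = 2 ^ (σ * k) * ((2:ℝ) ^ l) ^ d := by
      rw [Real.rpow_add two_pos, ← pow_mul]; congr 1; exact_mod_cast Real.rpow_natCast 2 (l * d)
    calc _ ≤ (2 ^ |σ| * 2 ^ (σ * k)) * (C * ((2:ℝ) ^ l) ^ d * decayWeight K l y x) := by gcongr
      _ = _ := by rw [h8]; ring
  · rw [LP_packet_eq_zero D hu hlk hj]
    simp only [norm_zero, mul_zero]
    positivity

/-! ### Lower bounds for the Littlewood–Paley kernel -/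

lemma exists_kernel_lower {d : ℕ} (D : LPData d) {u : RD d} (hu : ‖u‖ = 1) :
    ∃ (x₀ : RD d) (ρ c : ℝ), 0 < ρ ∧ 8 * ρ ≤ ‖x₀‖ ∧ 0 < c ∧
      ∀ x ∈ Metric.ball x₀ ρ, c ≤ ‖D.φ x‖ := by
  have hne : ∃ x₁, D.φ x₁ ≠ 0 := by
    by_contra hall
    push Not at hall
    have h0 : D.φ = 0 := by ext x; exact hall x
    have hu0 : u ≠ 0 := by rintro rfl; simp at hu
    have h1 := D.sum_φ u hu0
    have h2 : (fun k : ℤ => fourierS D.φ ((2:ℝ) ^ (-k) • u)) = fun _ => 0 := by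
      funext k; rw [h0, fourierS_apply]; simp
    rw [h2] at h1
    exact one_ne_zero (h1.unique hasSum_zero)
  obtain ⟨x₁, hx₁⟩ := hne
  have hex : ∃ x₀ : RD d, x₀ ≠ 0 ∧ D.φ x₀ ≠ 0 := by
    by_cases h : x₁ = 0
    · have hev : ∀ᶠ t : ℝ in nhdsWithin 0 {0}ᶜ, D.φ (t • u) ≠ 0 := by
        have hc : Continuous fun t : ℝ => D.φ (t • u) :=
          D.φ.continuous.comp (continuous_id.smul continuous_const)
        have : ∀ᶠ t : ℝ in nhds 0, D.φ (t • u) ≠ 0 :=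
          hc.continuousAt.eventually_ne (by simpa [h] using hx₁)
        exact this.filter_mono nhdsWithin_le_nhds
      obtain ⟨t, ht, ht0⟩ := (hev.and self_mem_nhdsWithin).exists
      refine ⟨t • u, smul_ne_zero ht0 ?_, ht⟩
      rintro rfl; simp at hu
    · exact ⟨x₁, h, hx₁⟩
  obtain ⟨x₀, hx0, hφ⟩ := hex
  have hpos : 0 < ‖D.φ x₀‖ := norm_pos_iff.2 hφ
  have hnear : ∀ᶠ x in nhds x₀, ‖D.φ x₀‖ / 2 < ‖D.φ x‖ :=
    continuousAt_const.eventually_lt D.φ.continuous.norm.continuousAt (by linarith)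
  obtain ⟨ρ, hρ, hball⟩ := Metric.eventually_nhds_iff_ball.1 hnear
  refine ⟨x₀, min ρ (‖x₀‖ / 8), ‖D.φ x₀‖ / 2, lt_min hρ (by positivity), ?_, by positivity, ?_⟩
  · linarith [min_le_right ρ (‖x₀‖ / 8)]
  · intro x hx
    exact (hball x (Metric.ball_subset_ball (min_le_left _ _) hx)).le

/-- The ball on which the kernel of scale `2^{-n}` centred at `y` is large. -/
def kernelBall {d : ℕ} (x₀ : RD d) (ρ : ℝ) (n : ℕ) (y : RD d) : Set (RD d) :=
  (fun x => (2:ℝ) ^ n • (x - y)) ⁻¹' Metric.ball x₀ ρ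

lemma measurableSet_kernelBall {d : ℕ} (x₀ : RD d) (ρ : ℝ) (n : ℕ) (y : RD d) :
    MeasurableSet (kernelBall x₀ ρ n y) :=
  (by fun_prop : Measurable fun x : RD d => (2:ℝ) ^ n • (x - y)) Metric.isOpen_ball.measurableSet

lemma volume_kernelBall {d : ℕ} (x₀ : RD d) (ρ : ℝ) (n : ℕ) (y : RD d) :
    volume (kernelBall x₀ ρ n y) =
      ENNReal.ofReal (((2:ℝ) ^ n) ^ d)⁻¹ * volume (Metric.ball x₀ ρ) := by
  rw [← lintegral_indicator_one (measurableSet_kernelBall x₀ ρ n y),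
    ← lintegral_indicator_one Metric.isOpen_ball.measurableSet, ← lintegral_comp_smul_sub _ n y]
  rfl

lemma norm_of_mem_kernelBall {d : ℕ} {x₀ : RD d} {ρ : ℝ} {n : ℕ} {y x : RD d}
    (hx : x ∈ kernelBall x₀ ρ n y) :
    ‖x₀‖ - ρ < 2 ^ n * ‖x - y‖ ∧ 2 ^ n * ‖x - y‖ < ‖x₀‖ + ρ := by
  have h : ‖(2:ℝ) ^ n • (x - y) - x₀‖ < ρ := mem_ball_iff_norm.1 hx
  have h1 := abs_lt.1 ((abs_norm_sub_norm_le _ _).trans_lt h)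
  rw [norm_smul, Real.norm_of_nonneg (by positivity)] at h1
  constructor <;> linarith [h1.1, h1.2]

lemma disjoint_kernelBall {d : ℕ} {x₀ : RD d} {ρ : ℝ} (hρ : 0 < ρ) (h8 : 8 * ρ ≤ ‖x₀‖) {n n' : ℕ}
    (hn : n ≠ n') (y : RD d) : Disjoint (kernelBall x₀ ρ n y) (kernelBall x₀ ρ n' y) := by
  wlog hlt : n < n' generalizing n n'
  · exact (this hn.symm (by omega)).symm
  rw [Set.disjoint_left]
  intro x hx hx'
  have h1 := norm_of_mem_kernelBall hx
  have h2 := norm_of_mem_kernelBall hx'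
  have h3 : (2:ℝ) ^ (n + 1) ≤ 2 ^ n' := pow_le_pow_right₀ one_le_two hlt
  have h4 : (2:ℝ) ^ (n + 1) * ‖x - y‖ ≤ 2 ^ n' * ‖x - y‖ := by gcongr
  have h5 : (2:ℝ) ^ (n + 1) * ‖x - y‖ = 2 * (2 ^ n * ‖x - y‖) := by ring
  linarith [h1.1, h2.2]

lemma lintegral_kernelBall_ge {d : ℕ} (D : LPData d) {x₀ : RD d} {ρ c : ℝ} (hc : 0 < c)
    (hφ : ∀ x ∈ Metric.ball x₀ ρ, c ≤ ‖D.φ x‖) {s r : ℝ} (hr : 0 < r) (hsr : (s + d) * r ≤ d)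
    {j k : ℕ} (hjk : j + 1 ≤ k) (y : RD d) :
    ENNReal.ofReal ((2:ℝ) ^ (-(k * d : ℝ)) * c ^ r) * volume (Metric.ball x₀ ρ) ≤
      ∫⁻ x in kernelBall x₀ ρ (j + 1) y, ENNReal.ofReal ((2:ℝ) ^ (s * ((j:ℝ) + 1)) *
        ((2:ℝ) ^ (-(k * (s + d))) * ‖LPkernel D (j + 1) (x - y)‖)) ^ r := by
  have hlow : ∀ x ∈ kernelBall x₀ ρ (j + 1) y,
      ENNReal.ofReal (((2:ℝ) ^ (((j:ℝ) + 1 - k) * (s + d)) * c) ^ r) ≤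
        ENNReal.ofReal ((2:ℝ) ^ (s * ((j:ℝ) + 1)) *
        ((2:ℝ) ^ (-(k * (s + d))) * ‖LPkernel D (j + 1) (x - y)‖)) ^ r := by
    intro x hx
    rw [ENNReal.ofReal_rpow_of_nonneg (by positivity) hr.le]
    refine ENNReal.ofReal_le_ofReal (Real.rpow_le_rpow (by positivity) ?_ hr.le)
    have h1 := hφ _ hx
    have h2 : ‖LPkernel D (j + 1) (x - y)‖ =
        (2:ℝ) ^ (((j:ℝ) + 1) * d) * ‖D.φ ((2:ℝ) ^ (j + 1) • (x - y))‖ := by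
      change ‖_ * D.φ _‖ = _
      rw [norm_mul, Complex.norm_real, Real.norm_of_nonneg (by positivity)]
      congr 1
      exact_mod_cast (Real.rpow_natCast 2 ((j + 1) * d)).symm
    rw [h2]
    calc _ ≤ (2:ℝ) ^ (((j:ℝ) + 1 - k) * (s + d)) * ‖D.φ ((2:ℝ) ^ (j + 1) • (x - y))‖ := by gcongr
      _ = ((2:ℝ) ^ (s * ((j:ℝ) + 1)) * (2:ℝ) ^ (-(k * (s + d))) * (2:ℝ) ^ (((j:ℝ) + 1) * d)) *
          ‖D.φ ((2:ℝ) ^ (j + 1) • (x - y))‖ := by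
        rw [← Real.rpow_add two_pos, ← Real.rpow_add two_pos]
        congr 2; ring
      _ = _ := by ring
  refine le_trans ?_ (setLIntegral_mono' (measurableSet_kernelBall _ _ _ _) hlow)
  rw [setLIntegral_const, volume_kernelBall, ← mul_assoc,
    ← ENNReal.ofReal_mul (by positivity)]
  refine mul_le_mul_left (ENNReal.ofReal_le_ofReal ?_) _
  rw [Real.mul_rpow (by positivity) hc.le, ← Real.rpow_mul two_pos.le]
  have h3 : (((2:ℝ) ^ (j + 1)) ^ d)⁻¹ = (2:ℝ) ^ (-(((j:ℝ) + 1) * d)) := by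
    rw [Real.rpow_neg two_pos.le, ← pow_mul]; congr 1
    exact_mod_cast (Real.rpow_natCast 2 ((j + 1) * d)).symm
  rw [h3, mul_right_comm, ← Real.rpow_add two_pos]
  gcongr
  · exact one_le_two
  · have h4 : (j:ℝ) + 1 ≤ k := by exact_mod_cast hjk
    nlinarith [mul_le_mul_of_nonneg_left hsr (sub_nonneg.2 h4)]

/-! ### A single wave packet -/

lemma two_rpow_shift (k : ℕ) (s m e : ℝ) :
    (((2:ℝ) ^ (-(k * (s + m + e)) : ℝ) : ℝ) : ℂ) * ((((2:ℝ) ^ k) ^ m : ℝ) : ℂ) =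
      ((2:ℝ) ^ (-(k * (s + e)) : ℝ) : ℝ) := by
  rw [← Complex.ofReal_mul, ← Real.rpow_natCast, ← Real.rpow_mul two_pos.le,
    ← Real.rpow_add two_pos]
  congr 2; ring

/-- If `(s + d) p ≤ d`, a single high-frequency packet moved to low frequencies shows unboundedness. -/
lemma unbounded_of_single_packet {d : ℕ} (D : LPData d) {u : RD d} (hu : ‖u‖ = 1) (m s : ℝ)
    {p q : ℝ≥0∞} (hp0 : p ≠ 0) (hp : p ≠ ⊤) (hq : q ≠ 0) (hs : (s + d) * p.toReal ≤ d)
    (C : ℝ≥0) : ∃ f : 𝓢(RD d, ℂ),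
      (C : ℝ≥0∞) * TLNorm D (s + m) p q f < TLNorm D s p q (pdo (shiftSymbol u m) f) := by
  set P := p.toReal with hPdef
  have hP : 0 < P := ENNReal.toReal_pos hp0 hp
  obtain ⟨K, hK⟩ := exists_nat_gt ((d:ℝ) / P)
  rw [div_lt_iff₀ hP] at hK
  obtain ⟨C₁, hC₁, hbound⟩ := exists_packet_term_bound D (s + m) K
  obtain ⟨x₀, ρ, c, hρ, h8, hc, hφ⟩ := exists_kernel_lower D hu
  set B : ℝ≥0∞ := ((3:ℝ≥0∞) ^ (1 / q.toReal) * ENNReal.ofReal C₁) ^ P *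
    ∫⁻ x : RD d, ENNReal.ofReal ((1 + ‖x‖) ^ (-(K * P))) with hB
  have hBtop : B ≠ ⊤ := by
    refine ENNReal.mul_ne_top (ENNReal.rpow_ne_top_of_nonneg hP.le (ENNReal.mul_ne_top
      (ENNReal.rpow_ne_top_of_nonneg (by positivity) (by simp)) ENNReal.ofReal_ne_top)) ?_
    exact (lintegral_one_add_norm_lt_top hK).ne
  set v : ℝ≥0∞ := ENNReal.ofReal (c ^ P) * volume (Metric.ball x₀ ρ) with hv
  have hv0 : v ≠ 0 := by
    refine mul_ne_zero (by simpa using Real.rpow_pos_of_pos hc P) ?_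
    exact (Metric.measure_ball_pos _ _ hρ).ne'
  obtain ⟨N, hN⟩ := ENNReal.exists_nat_mul_gt hv0
    (ENNReal.mul_ne_top (ENNReal.rpow_ne_top_of_nonneg hP.le (ENNReal.coe_ne_top (r := C))) hBtop)
  set k := N + 6 with hk
  set δ : ℝ≥0∞ := ENNReal.ofReal ((2:ℝ) ^ (-(k * d : ℝ))) with hδ
  have hδ0 : δ ≠ 0 := by
    have : (0:ℝ) < (2:ℝ) ^ (-(k * d : ℝ)) := by positivity
    simpa [hδ] using this
  set f : 𝓢(RD d, ℂ) := ∑ t ∈ ({k} : Finset ℕ),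
    (((2:ℝ) ^ (-(t * (s + m + d)) : ℝ) : ℝ) : ℂ) • packet ((2:ℝ) ^ t • u) t 0 with hf
  have hTf := pdo_sum_packet hu m ({k} : Finset ℕ)
    (fun t => (((2:ℝ) ^ (-(t * (s + m + d)) : ℝ) : ℝ) : ℂ)) id id (fun _ => 0) (fun _ _ => le_rfl)
  simp only [id] at hTf
  refine ⟨f, ?_⟩
  have hin : TLNorm D (s + m) p q f ≤ (B * δ) ^ (1 / P) := by
    rw [TLNorm_eq D _ q hp, lpNormFun_zero d hp0 hp, zero_add]
    · refine ENNReal.rpow_le_rpow ?_ (by positivity)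
      have hpt : ∀ x, ellNorm q (fun j => lpTerm D (s + m) f j x) ≤
          (3:ℝ≥0∞) ^ (1 / q.toReal) * ENNReal.ofReal (C₁ * decayWeight K k 0 x) := by
        intro x
        refine (ellNorm_le_of_support hq (Finset.Icc (k - 2) k)
          (B := ENNReal.ofReal (C₁ * decayWeight K k 0 x)) ?_ ?_).trans ?_
        · intro j hj
          rw [lpTerm, hf, LP_sum, Finset.sum_singleton, LP_packet_eq_zero D hu le_rfl]
          · simp
          · rw [Finset.mem_Icc] at hj; omega
        · intro j
          rw [lpTerm, hf, LP_sum, Finset.sum_singleton]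
          refine ENNReal.ofReal_le_ofReal ?_
          have h1 := hbound u hu k k j 0 x le_rfl
          rw [norm_mul, Complex.norm_real, Real.norm_of_nonneg (by positivity)]
          calc _ = (2:ℝ) ^ (-(k * (s + m + d)) : ℝ) * ((2:ℝ) ^ ((s + m) * ((j:ℝ) + 1)) *
                ‖LP D (j + 1) (packet ((2:ℝ) ^ k • u) k 0) x‖) := by ring
            _ ≤ (2:ℝ) ^ (-(k * (s + m + d)) : ℝ) *
                (C₁ * (2:ℝ) ^ ((s + m) * k + k * d) * decayWeight K k 0 x) := by gcongr
            _ = ((2:ℝ) ^ (-(k * (s + m + d)) : ℝ) * (2:ℝ) ^ ((s + m) * k + k * d)) *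
                (C₁ * decayWeight K k 0 x) := by ring
            _ = C₁ * decayWeight K k 0 x := by
                rw [← Real.rpow_add two_pos]; ring_nf; simp
        · gcongr
          simp only [Nat.card_Icc]
          exact_mod_cast (by omega : k + 1 - (k - 2) ≤ 3)
      calc _ ≤ ∫⁻ x, ((3:ℝ≥0∞) ^ (1 / q.toReal) * ENNReal.ofReal C₁) ^ P *
            ENNReal.ofReal (decayWeight (K * P) k 0 x) := by
              refine lintegral_mono fun x => ?_
              refine (ENNReal.rpow_le_rpow (hpt x) hP.le).trans (le_of_eq ?_)
              rw [ENNReal.ofReal_mul hC₁, ← mul_assoc, ENNReal.mul_rpow_of_nonneg _ _ hP.le,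
                ENNReal.ofReal_rpow_of_nonneg (decayWeight_nonneg _ _ _ _) hP.le, decayWeight_rpow]
        _ = B * δ := by
            rw [lintegral_const_mul' _ _ (ENNReal.rpow_ne_top_of_nonneg hP.le (ENNReal.mul_ne_top
              (ENNReal.rpow_ne_top_of_nonneg (by positivity) (by simp)) ENNReal.ofReal_ne_top)),
              lintegral_decayWeight, hB, hδ, Real.rpow_neg two_pos.le, ← pow_mul]
            have : ((2:ℝ) ^ (k * d)) = (2:ℝ) ^ (k * d : ℝ) := by
              exact_mod_cast (Real.rpow_natCast 2 (k * d)).symm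
            rw [this]; ring
    · intro x
      rw [hf, LP_sum, Finset.sum_singleton, LP_zero_packet_eq_zero D hu le_rfl (by omega), mul_zero]
  have hout : (N * v * δ) ^ (1 / P) ≤ TLNorm D s p q (pdo (shiftSymbol u m) f) := by
    rw [TLNorm_eq D _ q hp]
    refine le_trans ?_ le_add_self
    refine ENNReal.rpow_le_rpow ?_ (by positivity)
    have hpiece : ∀ j ∈ Finset.range N, v * δ ≤ ∫⁻ x in kernelBall x₀ ρ (j + 1) 0,
        ellNorm q (fun j => lpTerm D s (pdo (shiftSymbol u m) f) j x) ^ P := by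
      intro j hj
      have hjN := Finset.mem_range.1 hj
      refine le_trans ?_ ((lintegral_kernelBall_ge D hc hφ hP hs (j := j) (k := k) (by omega)
        0).trans (lintegral_mono fun x => ?_))
      · rw [hv, hδ, ENNReal.ofReal_mul (by positivity)]
        exact le_of_eq (by ring)
      · refine ENNReal.rpow_le_rpow (le_trans (le_of_eq ?_) (le_ellNorm hq _ j)) hP.le
        rw [lpTerm, hf, hTf, LP_sum, Finset.sum_singleton, two_rpow_shift, norm_mul,
          Complex.norm_real, Real.norm_of_nonneg (by positivity),
          LP_packet_zero_eq_kernel D (by omega)]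
    calc (N * v * δ : ℝ≥0∞) = ∑ j ∈ Finset.range N, v * δ := by simp [mul_assoc]
      _ ≤ ∑ j ∈ Finset.range N, ∫⁻ x in kernelBall x₀ ρ (j + 1) 0,
        ellNorm q (fun j => lpTerm D s (pdo (shiftSymbol u m) f) j x) ^ P :=
          Finset.sum_le_sum hpiece
      _ = ∫⁻ x in ⋃ j ∈ Finset.range N, kernelBall x₀ ρ (j + 1) 0,
        ellNorm q (fun j => lpTerm D s (pdo (shiftSymbol u m) f) j x) ^ P := by
          rw [lintegral_biUnion_finset]
          · intro j _ j' _ hjj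
            exact disjoint_kernelBall hρ h8 (by omega) 0
          · exact fun j _ => measurableSet_kernelBall _ _ _ _
      _ ≤ _ := setLIntegral_le_lintegral _ _
  calc (C : ℝ≥0∞) * TLNorm D (s + m) p q f ≤ C * (B * δ) ^ (1 / P) := by gcongr
    _ = ((C : ℝ≥0∞) ^ P * B * δ) ^ (1 / P) := by
        rw [mul_assoc ((C : ℝ≥0∞) ^ P) B δ,
          ENNReal.mul_rpow_of_nonneg ((C : ℝ≥0∞) ^ P) (B * δ) (by positivity),
          ← ENNReal.rpow_mul (C : ℝ≥0∞), mul_one_div_cancel hP.ne', ENNReal.rpow_one]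
    _ < (N * v * δ) ^ (1 / P) := by
        refine ENNReal.rpow_lt_rpow ?_ (by positivity)
        exact (ENNReal.mul_lt_mul_iff_left hδ0 ENNReal.ofReal_ne_top).2 hN
    _ ≤ _ := hout

/-! ### Many frequencies moved to the origin -/

/-- The sum of unit-scale packets at frequencies `2^k u`, `3 ≤ k < N + 3`. -/
def lacunarySum {d : ℕ} (u : RD d) (m : ℝ) (N : ℕ) : 𝓢(RD d, ℂ) :=
  ∑ k ∈ Finset.Ico 3 (N + 3), (((2:ℝ) ^ (-(k * m) : ℝ) : ℝ) : ℂ) • packet ((2:ℝ) ^ k • u) 0 0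

lemma pdo_lacunarySum {d : ℕ} {u : RD d} (hu : ‖u‖ = 1) (m : ℝ) (N : ℕ) :
    pdo (shiftSymbol u m) (lacunarySum u m N) =
      ⇑(∑ _k ∈ Finset.Ico 3 (N + 3), (1:ℂ) • packet (0 : RD d) 0 0) := by
  have h := pdo_sum_packet hu m (Finset.Ico 3 (N + 3))
    (fun k => (((2:ℝ) ^ (-(k * m) : ℝ) : ℝ) : ℂ)) id (fun _ => 0) (fun _ => 0)
    (fun _ _ => Nat.zero_le _)
  simp only [id] at h
  rw [lacunarySum, h]
  refine congrArg (fun g : 𝓢(RD d, ℂ) => (⇑g : RD d → ℂ)) (Finset.sum_congr rfl fun _ _ => ?_)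
  congr 1
  rw [← Complex.ofReal_mul, ← Real.rpow_natCast, ← Real.rpow_mul two_pos.le,
    ← Real.rpow_add two_pos]
  simp

lemma LP_zero_pdo_lacunarySum {d : ℕ} (D : LPData d) {u : RD d} (hu : ‖u‖ = 1) (m : ℝ) (N : ℕ)
    (x : RD d) :
    LP D 0 (pdo (shiftSymbol u m) (lacunarySum u m N)) x = N * packet (0 : RD d) 0 0 x := by
  rw [pdo_lacunarySum hu, LP_sum]
  simp [LP_zero_packet_zero]

lemma LP_zero_lacunarySum {d : ℕ} (D : LPData d) {u : RD d} (hu : ‖u‖ = 1) (m : ℝ) (N : ℕ)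
    (x : RD d) : LP D 0 (lacunarySum u m N) x = 0 := by
  rw [lacunarySum, LP_sum]
  refine Finset.sum_eq_zero fun k hk => ?_
  rw [LP_zero_packet_eq_zero D hu (Nat.zero_le _) (Finset.mem_Ico.1 hk).1, mul_zero]

lemma lpTerm_lacunarySum_eq_zero {d : ℕ} (D : LPData d) {u : RD d} (hu : ‖u‖ = 1) (s m : ℝ)
    {N j : ℕ} (hj : j ∉ Finset.range (N + 3)) (x : RD d) :
    lpTerm D s (lacunarySum u m N) j x = 0 := by
  rw [lpTerm, lacunarySum, LP_sum, Finset.sum_eq_zero]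
  · simp
  · intro k hk
    rw [Finset.mem_range] at hj
    rw [Finset.mem_Ico] at hk
    rw [LP_packet_eq_zero D hu (Nat.zero_le _) (by omega), mul_zero]

lemma exists_lpTerm_lacunarySum_le {d : ℕ} (D : LPData d) {s : ℝ} (hs : s ≤ 0) (m : ℝ) (K : ℕ) :
    ∃ C : ℝ, 0 ≤ C ∧ ∀ u : RD d, ‖u‖ = 1 → ∀ N j x,
      lpTerm D (s + m) (lacunarySum u m N) j x ≤ ENNReal.ofReal (C * decayWeight K 0 0 x) := by
  obtain ⟨C, hC, hbound⟩ := exists_packet_term_bound D (s + m) K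
  refine ⟨3 * C, by positivity, fun u hu N j x => ENNReal.ofReal_le_ofReal ?_⟩
  have hw := decayWeight_nonneg K 0 0 x
  have hterm : ∀ k : ℕ, (2:ℝ) ^ ((s + m) * ((j:ℝ) + 1)) *
      ‖(((2:ℝ) ^ (-(k * m) : ℝ) : ℝ) : ℂ) * LP D (j + 1) (packet ((2:ℝ) ^ k • u) 0 0) x‖ ≤
        C * decayWeight K 0 0 x := by
    intro k
    have h1 := hbound u hu k 0 j 0 x (Nat.zero_le _)
    rw [norm_mul, Complex.norm_real, Real.norm_of_nonneg (by positivity)]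
    calc _ = (2:ℝ) ^ (-(k * m) : ℝ) * ((2:ℝ) ^ ((s + m) * ((j:ℝ) + 1)) *
          ‖LP D (j + 1) (packet ((2:ℝ) ^ k • u) 0 0) x‖) := by ring
      _ ≤ (2:ℝ) ^ (-(k * m) : ℝ) *
          (C * (2:ℝ) ^ ((s + m) * k + (0:ℕ) * d) * decayWeight K 0 0 x) := by gcongr
      _ = ((2:ℝ) ^ (-(k * m) : ℝ) * (2:ℝ) ^ ((s + m) * k + (0:ℕ) * d)) *
          (C * decayWeight K 0 0 x) := by ring
      _ = (2:ℝ) ^ (s * k) * (C * decayWeight K 0 0 x) := by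
          rw [← Real.rpow_add two_pos]; congr 2; push_cast; ring
      _ ≤ 1 * (C * decayWeight K 0 0 x) := by
          gcongr
          exact Real.rpow_le_one_of_one_le_of_nonpos one_le_two
            (mul_nonpos_of_nonpos_of_nonneg hs (by positivity))
      _ = _ := one_mul _
  set T := (Finset.Ico 3 (N + 3)).filter fun k => k ≤ j + 2 ∧ j ≤ k with hT
  have hcard : T.card ≤ 3 := by
    have : T ⊆ Finset.Icc j (j + 2) := by
      intro k hk
      rw [hT, Finset.mem_filter] at hk
      exact Finset.mem_Icc.2 ⟨hk.2.2, hk.2.1⟩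
    refine (Finset.card_le_card this).trans ?_
    simp only [Nat.card_Icc]; omega
  rw [lacunarySum, LP_sum, ← Finset.sum_filter_of_ne (p := fun k => k ≤ j + 2 ∧ j ≤ k)]
  · calc _ ≤ (2:ℝ) ^ ((s + m) * ((j:ℝ) + 1)) * ∑ k ∈ T, ‖(((2:ℝ) ^ (-(k * m) : ℝ) : ℝ) : ℂ) *
            LP D (j + 1) (packet ((2:ℝ) ^ k • u) 0 0) x‖ := by
          gcongr; exact norm_sum_le _ _
      _ ≤ ∑ k ∈ T, C * decayWeight K 0 0 x := by
          rw [Finset.mul_sum]; exact Finset.sum_le_sum fun k _ => hterm k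
      _ = T.card * (C * decayWeight K 0 0 x) := by simp
      _ ≤ 3 * (C * decayWeight K 0 0 x) := by gcongr; exact_mod_cast hcard
      _ = _ := by ring
  · intro k _ hne
    by_contra hj
    exact hne (by rw [LP_packet_eq_zero D hu (Nat.zero_le _) hj, mul_zero])

lemma exists_packet_ne_zero (d : ℕ) : ∃ x : RD d, packet (0 : RD d) 0 0 x ≠ 0 := by
  by_contra hall
  push Not at hall
  have h0 : packet (0 : RD d) 0 0 = 0 := by ext x; exact hall x
  have h1 := fourierS_packet (0 : RD d) 0 0 0
  rw [packetHat_eq_plane (by simp), sub_zero, plane_zero_right, h0, fourierS_apply] at h1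
  simp at h1

lemma exists_nat_lt_of_sublinear {θ : ℝ} (hθ0 : 0 ≤ θ) (hθ : θ < 1) {B h : ℝ≥0∞} (hB : B ≠ ⊤)
    (hh : h ≠ 0) : ∃ N : ℕ, B * ((N + 3 : ℕ) : ℝ≥0∞) ^ θ < N * h := by
  have htend : Tendsto (fun N : ℕ => ((N:ℝ≥0∞)) ^ (1 - θ)) atTop (nhds ⊤) := by
    have h1 : Tendsto (fun N : ℕ => ENNReal.ofReal ((N:ℝ) ^ (1 - θ))) atTop (nhds ⊤) :=
      ENNReal.tendsto_ofReal_atTop.comp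
        ((tendsto_rpow_atTop (by linarith)).comp tendsto_natCast_atTop_atTop)
    refine h1.congr fun N => ?_
    rw [← ENNReal.ofReal_rpow_of_nonneg (by positivity) (by linarith), ENNReal.ofReal_natCast]
  have hlim : Tendsto (fun N : ℕ => ((N:ℝ≥0∞)) ^ (1 - θ) * h) atTop (nhds ⊤) := by
    have := ENNReal.Tendsto.mul_const htend (b := h) (Or.inl ENNReal.top_ne_zero)
    rwa [ENNReal.top_mul hh] at this
  have hev := hlim.eventually_const_lt (lt_top_iff_ne_top.2
    (ENNReal.mul_ne_top hB (ENNReal.rpow_ne_top_of_nonneg hθ0 (by simp : (4:ℝ≥0∞) ≠ ⊤))))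
  obtain ⟨N, hN, hN1⟩ := (hev.and (eventually_ge_atTop 1)).exists
  refine ⟨N, ?_⟩
  have hNpos : (N:ℝ≥0∞) ≠ 0 := by simp; omega
  have hNtop : (N:ℝ≥0∞) ≠ ⊤ := by simp
  calc B * ((N + 3 : ℕ) : ℝ≥0∞) ^ θ ≤ B * ((4 * N : ℕ) : ℝ≥0∞) ^ θ := by
        gcongr; omega
    _ = B * 4 ^ θ * (N:ℝ≥0∞) ^ θ := by
        push_cast; rw [ENNReal.mul_rpow_of_nonneg _ _ hθ0, mul_assoc]
    _ < ((N:ℝ≥0∞)) ^ (1 - θ) * h * (N:ℝ≥0∞) ^ θ := by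
        refine (ENNReal.mul_lt_mul_iff_left ?_ ?_).2 hN
        · simp [hNpos]
        · exact ENNReal.rpow_ne_top_of_nonneg hθ0 hNtop
    _ = N * h := by
        rw [mul_right_comm, ← ENNReal.rpow_add _ _ hNpos hNtop]; simp

/-- For `q > 1`, `s ≤ 0` and finite `p`, a lacunary sum shows unboundedness. -/
lemma unbounded_of_lacunary {d : ℕ} (D : LPData d) {u : RD d} (hu : ‖u‖ = 1) (m : ℝ) {s : ℝ}
    (hs : s ≤ 0) {p q : ℝ≥0∞} (hp0 : p ≠ 0) (hp : p ≠ ⊤) (hq : 1 < q) (C : ℝ≥0) :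
    ∃ f : 𝓢(RD d, ℂ),
      (C : ℝ≥0∞) * TLNorm D (s + m) p q f < TLNorm D s p q (pdo (shiftSymbol u m) f) := by
  have hq0 : q ≠ 0 := (zero_lt_one.trans hq).ne'
  set P := p.toReal with hPdef
  have hP : 0 < P := ENNReal.toReal_pos hp0 hp
  obtain ⟨K, hK⟩ := exists_nat_gt ((d:ℝ) / P)
  rw [div_lt_iff₀ hP] at hK
  obtain ⟨C₁, hC₁, hterm⟩ := exists_lpTerm_lacunarySum_le D hs m K
  set I : ℝ≥0∞ := ∫⁻ x : RD d, ENNReal.ofReal (C₁ * decayWeight K 0 0 x) ^ P with hI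
  have hItop : I ≠ ⊤ := by
    have : I = ∫⁻ x : RD d, ENNReal.ofReal C₁ ^ P * ENNReal.ofReal (decayWeight (K * P) 0 0 x) := by
      refine lintegral_congr fun x => ?_
      rw [ENNReal.ofReal_mul hC₁, ENNReal.mul_rpow_of_nonneg _ _ hP.le,
        ENNReal.ofReal_rpow_of_nonneg (decayWeight_nonneg _ _ _ _) hP.le, decayWeight_rpow]
    have hc : ENNReal.ofReal C₁ ^ P ≠ ⊤ :=
      ENNReal.rpow_ne_top_of_nonneg hP.le ENNReal.ofReal_ne_top
    rw [this, lintegral_const_mul' _ _ hc, lintegral_decayWeight]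
    exact ENNReal.mul_ne_top hc (ENNReal.mul_ne_top ENNReal.ofReal_ne_top
      (lintegral_one_add_norm_lt_top hK).ne)
  set h : ℝ≥0∞ := lpNormFun d p (packet (0 : RD d) 0 0) with hh
  have hh0 : h ≠ 0 := by
    intro h0
    rw [hh, lpNormFun, if_neg hp, ENNReal.rpow_eq_zero_iff_of_pos (by positivity),
      lintegral_eq_zero_iff (by fun_prop)] at h0
    have h1 : (packet (0 : RD d) 0 0 : RD d → ℂ) =ᵐ[volume] fun _ => 0 := by
      filter_upwards [h0] with x hx
      have hx' : (‖packet (0 : RD d) 0 0 x‖₊ : ℝ≥0∞) ^ P = 0 := hx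
      simpa [ENNReal.rpow_eq_zero_iff_of_pos hP] using hx'
    have h2 := (packet (0 : RD d) 0 0).continuous.ae_eq_iff_eq volume continuous_const |>.1 h1
    obtain ⟨x, hx⟩ := exists_packet_ne_zero d
    exact hx (congrFun h2 x)
  have hθ : 1 / q.toReal < 1 := by
    rcases eq_or_ne q ⊤ with rfl | hqt
    · simp
    · have : 1 < q.toReal := by simpa using (ENNReal.toReal_lt_toReal (by simp) hqt).2 hq
      rw [div_lt_one (by linarith)]; exact this
  obtain ⟨N, hN⟩ := exists_nat_lt_of_sublinear (θ := 1 / q.toReal) (by positivity) hθ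
    (B := C * I ^ (1 / P)) (ENNReal.mul_ne_top ENNReal.coe_ne_top
      (ENNReal.rpow_ne_top_of_nonneg (by positivity) hItop)) hh0
  refine ⟨lacunarySum u m N, ?_⟩
  have hin : TLNorm D (s + m) p q (lacunarySum u m N) ≤
      ((N + 3 : ℕ) : ℝ≥0∞) ^ (1 / q.toReal) * I ^ (1 / P) := by
    rw [TLNorm_eq D _ q hp, lpNormFun_zero d hp0 hp (LP_zero_lacunarySum D hu m N), zero_add]
    have hpt : ∀ x, ellNorm q (fun j => lpTerm D (s + m) (lacunarySum u m N) j x) ≤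
        ((N + 3 : ℕ) : ℝ≥0∞) ^ (1 / q.toReal) * ENNReal.ofReal (C₁ * decayWeight K 0 0 x) := by
      intro x
      have := ellNorm_le_of_support hq0 (Finset.range (N + 3))
        (fun j hj => lpTerm_lacunarySum_eq_zero D hu (s + m) m hj x)
        (fun j => hterm u hu N j x)
      rwa [Finset.card_range] at this
    have hnt : ((N + 3 : ℕ) : ℝ≥0∞) ^ (1 / q.toReal) ≠ ⊤ :=
      ENNReal.rpow_ne_top_of_nonneg (by positivity) (ENNReal.natCast_ne_top _)
    calc _ ≤ (∫⁻ x, (((N + 3 : ℕ) : ℝ≥0∞) ^ (1 / q.toReal)) ^ P *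
          ENNReal.ofReal (C₁ * decayWeight K 0 0 x) ^ P) ^ (1 / P) := by
            refine ENNReal.rpow_le_rpow (lintegral_mono fun x => ?_) (by positivity)
            rw [← ENNReal.mul_rpow_of_nonneg _ _ hP.le]
            exact ENNReal.rpow_le_rpow (hpt x) hP.le
      _ = _ := by
            rw [lintegral_const_mul' _ _ (ENNReal.rpow_ne_top_of_nonneg hP.le hnt), ← hI,
              ENNReal.mul_rpow_of_nonneg _ _ (by positivity), ← ENNReal.rpow_mul _ P,
              mul_one_div_cancel hP.ne', ENNReal.rpow_one]
  have hout : N * h ≤ TLNorm D s p q (pdo (shiftSymbol u m) (lacunarySum u m N)) := by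
    rw [TLNorm_eq D _ q hp]
    refine le_trans (le_of_eq ?_) le_self_add
    rw [hh, lpNormFun, if_neg hp, lpNormFun, if_neg hp, ← hPdef]
    simp only [LP_zero_pdo_lacunarySum D hu, nnnorm_mul, ENNReal.coe_mul,
      ENNReal.mul_rpow_of_nonneg _ _ hP.le]
    rw [lintegral_const_mul' _ _ (ENNReal.rpow_ne_top_of_nonneg hP.le ENNReal.coe_ne_top),
      ENNReal.mul_rpow_of_nonneg _ _ (by positivity), ← ENNReal.rpow_mul _ P,
      mul_one_div_cancel hP.ne', ENNReal.rpow_one]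
    simp
  calc (C : ℝ≥0∞) * TLNorm D (s + m) p q (lacunarySum u m N)
      ≤ C * (((N + 3 : ℕ) : ℝ≥0∞) ^ (1 / q.toReal) * I ^ (1 / P)) := by gcongr
    _ = C * I ^ (1 / P) * ((N + 3 : ℕ) : ℝ≥0∞) ^ (1 / q.toReal) := by ring
    _ < N * h := hN
    _ ≤ _ := hout

/-- The endpoint `p = q = ∞`. -/
lemma unbounded_of_lacunary_top {d : ℕ} (D : LPData d) {u : RD d} (hu : ‖u‖ = 1) (m : ℝ) {s : ℝ}
    (hs : s ≤ 0) (C : ℝ≥0) :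
    ∃ f : 𝓢(RD d, ℂ), (C : ℝ≥0∞) * TLNorm D (s + m) ⊤ ⊤ f <
      TLNorm D s ⊤ ⊤ (pdo (shiftSymbol u m) f) := by
  obtain ⟨C₁, hC₁, hterm⟩ := exists_lpTerm_lacunarySum_le D hs m 0
  obtain ⟨x₁, hx₁⟩ := exists_packet_ne_zero d
  obtain ⟨N, hN⟩ := ENNReal.exists_nat_mul_gt (a := (‖packet (0 : RD d) 0 0 x₁‖₊ : ℝ≥0∞))
    (b := C * ENNReal.ofReal C₁) (by simpa using hx₁)
    (ENNReal.mul_ne_top ENNReal.coe_ne_top ENNReal.ofReal_ne_top)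
  refine ⟨lacunarySum u m N, ?_⟩
  have hin : TLNorm D (s + m) ⊤ ⊤ (lacunarySum u m N) ≤ ENNReal.ofReal C₁ := by
    rw [TLNorm, if_pos rfl]
    refine iSup_le fun k => ?_
    rw [ENNReal.mul_iSup]
    refine iSup_le fun x => ?_
    cases k with
    | zero => simp [LP_zero_lacunarySum D hu]
    | succ j =>
      rw [two_rpow_mul_nnnorm]
      have := hterm u hu N j x
      simpa [lpTerm, decayWeight] using this
  have hout : N * (‖packet (0 : RD d) 0 0 x₁‖₊ : ℝ≥0∞) ≤
      TLNorm D s ⊤ ⊤ (pdo (shiftSymbol u m) (lacunarySum u m N)) := by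
    rw [TLNorm, if_pos rfl]
    refine le_trans ?_ (le_iSup _ 0)
    rw [ENNReal.mul_iSup]
    refine le_trans ?_ (le_iSup _ x₁)
    rw [LP_zero_pdo_lacunarySum D hu]
    simp
  calc (C : ℝ≥0∞) * TLNorm D (s + m) ⊤ ⊤ (lacunarySum u m N) ≤ C * ENNReal.ofReal C₁ := by gcongr
    _ < _ := hN
    _ ≤ _ := hout

/-! ### Choosing the centres of many packets by averaging -/

/-- A product of independent factors can be kept below its mean by choosing the parameters one at a
time. -/
lemma exists_prod_le_laverage {ι X : Type*} [MeasurableSpace X] {μ : Measure X} [SFinite μ]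
    (S : Finset ι) {E : ι → Set X} (hE0 : ∀ t, μ (E t) ≠ 0) (hE : ∀ t, μ (E t) ≠ ⊤)
    {G : ι → X → X → ℝ≥0∞} (hG : ∀ t, Measurable (Function.uncurry (G t))) {g : X → ℝ≥0∞}
    (hg : Measurable g) :
    ∃ y : ι → X, (∀ t, y t ∈ E t) ∧ ∫⁻ x, g x * ∏ t ∈ S, G t (y t) x ∂μ ≤
      ∫⁻ x, g x * ∏ t ∈ S, (⨍⁻ z in E t, G t z x ∂μ) ∂μ := by
  classical
  have havg : ∀ t, Measurable fun x => ⨍⁻ z in E t, G t z x ∂μ := by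
    intro t
    simp only [setLAverage_eq]
    exact (Measurable.lintegral_prod_left' (hG t)).div_const _
  induction S using Finset.induction_on generalizing g with
  | empty =>
    have : ∀ t, ∃ z, z ∈ E t := fun t => nonempty_of_measure_ne_zero (hE0 t)
    choose y hy using this
    exact ⟨y, hy, by simp⟩
  | insert a S ha ih =>
    set h : X → ℝ≥0∞ := fun x => g x * ∏ t ∈ S, (⨍⁻ z in E t, G t z x ∂μ) with hh
    have hhm : Measurable h := hg.mul (Finset.measurable_prod _ fun t _ => havg t)
    have hF : Measurable (Function.uncurry fun z x => h x * G a z x) :=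
      (hhm.comp measurable_snd).mul (hG a)
    obtain ⟨z, hz, hle⟩ := exists_le_setLAverage (hE0 a) (hE a)
      (f := fun z => ∫⁻ x, h x * G a z x ∂μ) (Measurable.lintegral_prod_right' hF).aemeasurable
    obtain ⟨y, hy, hyle⟩ := ih (g := fun x => g x * G a z x)
      (hg.mul ((hG a).comp measurable_prodMk_left))
    refine ⟨Function.update y a z, fun t => ?_, ?_⟩
    · rcases eq_or_ne t a with rfl | hta
      · simpa using hz
      · simpa [hta] using hy t
    · calc _ = ∫⁻ x, g x * G a z x * ∏ t ∈ S, G t (y t) x ∂μ := by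
            refine lintegral_congr fun x => ?_
            rw [Finset.prod_insert ha, Function.update_self, mul_assoc]
            congr 2
            refine Finset.prod_congr rfl fun t ht => ?_
            rw [Function.update_of_ne (by rintro rfl; exact ha ht)]
        _ ≤ ∫⁻ x, g x * G a z x * ∏ t ∈ S, (⨍⁻ z in E t, G t z x ∂μ) ∂μ := hyle
        _ = ∫⁻ x, h x * G a z x ∂μ := lintegral_congr fun x => by simp only [hh]; ring
        _ ≤ ⨍⁻ z in E a, ∫⁻ x, h x * G a z x ∂μ ∂μ := hle
        _ = ∫⁻ x, h x * (⨍⁻ z in E a, G a z x ∂μ) ∂μ := by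
            rw [setLAverage_eq, lintegral_lintegral_swap hF.aemeasurable, ENNReal.div_eq_inv_mul,
              ← lintegral_const_mul' _ _ (ENNReal.inv_ne_top.2 (hE0 a))]
            refine lintegral_congr fun x => ?_
            have hGx : Measurable fun z => G a z x := (hG a).comp measurable_prodMk_right
            rw [setLAverage_eq, lintegral_const_mul _ hGx,
              ENNReal.div_eq_inv_mul]
            ring
        _ = _ := by
            refine lintegral_congr fun x => ?_
            rw [Finset.prod_insert ha]; simp only [hh]; ring

lemma prod_one_add_le_exp {ι : Type*} (S : Finset ι) {b : ι → ℝ≥0∞} {A : ℝ} (hA : 0 ≤ A)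
    (hb : ∑ t ∈ S, b t ≤ ENNReal.ofReal A) :
    ∏ t ∈ S, (1 + b t) ≤ ENNReal.ofReal (Real.exp A) := by
  have hne : ∀ t ∈ S, b t ≠ ⊤ := fun t ht =>
    ((Finset.single_le_sum (fun _ _ => zero_le) ht).trans_lt
      (hb.trans_lt ENNReal.ofReal_lt_top)).ne
  calc ∏ t ∈ S, (1 + b t) ≤ ∏ t ∈ S, ENNReal.ofReal (Real.exp (b t).toReal) := by
        refine Finset.prod_le_prod' fun t ht => ?_
        rw [← ENNReal.ofReal_toReal (hne t ht), ← ENNReal.ofReal_one,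
          ← ENNReal.ofReal_add zero_le_one ENNReal.toReal_nonneg,
          ENNReal.toReal_ofReal ENNReal.toReal_nonneg]
        exact ENNReal.ofReal_le_ofReal (by linarith [Real.add_one_le_exp (b t).toReal])
    _ = ENNReal.ofReal (Real.exp (∑ t ∈ S, b t).toReal) := by
        rw [← ENNReal.ofReal_prod_of_nonneg fun _ _ => (Real.exp_pos _).le, ← Real.exp_sum,
          ENNReal.toReal_sum hne]
    _ ≤ _ := by
        refine ENNReal.ofReal_le_ofReal (Real.exp_le_exp.2 ?_)
        exact ENNReal.toReal_le_of_le_ofReal hA hb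

lemma exists_rpow_le_exp (r : ℝ) (hr : 0 ≤ r) :
    ∃ C : ℝ, 0 ≤ C ∧ ∀ t : ℝ, 0 ≤ t → t ^ r ≤ C * Real.exp t := by
  obtain ⟨n, hn⟩ := exists_nat_ge r
  refine ⟨1 + n.factorial, by positivity, fun t ht => ?_⟩
  have hexp : 1 ≤ Real.exp t := Real.one_le_exp ht
  rcases le_total t 1 with h | h
  · have := Real.rpow_le_one ht h hr
    nlinarith [Real.exp_pos t, (by positivity : (0:ℝ) ≤ n.factorial * Real.exp t)]
  · have h1 : t ^ r ≤ t ^ n := by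
      rw [← Real.rpow_natCast]; exact Real.rpow_le_rpow_of_exponent_le h hn
    have h2 := Real.pow_div_factorial_le_exp t ht n
    rw [div_le_iff₀ (by positivity)] at h2
    nlinarith [Real.exp_pos t]

/-- The dyadic lattice point `2^{-l} n`. -/
def latticePoint {d : ℕ} (l : ℕ) (n : Fin d → ℕ) : RD d :=
  ((2:ℝ) ^ l)⁻¹ • WithLp.toLp 2 fun i => (n i : ℝ)

lemma norm_latticePoint_le {d l : ℕ} {n : Fin d → ℕ} (hn : ∀ i, n i < 2 ^ l) :
    ‖latticePoint l n‖ ≤ d := by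
  have h1 : ‖latticePoint l n‖ ^ 2 ≤ (d:ℝ) ^ 2 := by
    rw [EuclideanSpace.norm_sq_eq]
    calc _ ≤ ∑ _i : Fin d, (1:ℝ) := by
          refine Finset.sum_le_sum fun i _ => ?_
          have h : ‖(latticePoint l n).ofLp i‖ ≤ 1 := by
            have hi : (n i : ℝ) ≤ 2 ^ l := by exact_mod_cast (hn i).le
            simp only [latticePoint, PiLp.smul_apply, smul_eq_mul, norm_mul, norm_inv, norm_pow,
              Real.norm_ofNat, Real.norm_natCast]
            rw [inv_mul_le_iff₀ (by positivity), mul_one]; exact hi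
          exact pow_le_one₀ (norm_nonneg _) h
      _ = d := by simp
      _ ≤ _ := by exact_mod_cast Nat.le_self_pow two_ne_zero d
  exact abs_le_of_sq_le_sq' h1 (by positivity) |>.2

lemma le_norm_latticePoint_sub {d l : ℕ} {n n' : Fin d → ℕ} (h : n ≠ n') :
    1 ≤ 2 ^ l * ‖latticePoint l n - latticePoint l n'‖ := by
  obtain ⟨i, hi⟩ := Function.ne_iff.1 h
  have h1 := PiLp.norm_apply_le (latticePoint l n - latticePoint l n') i
  have h2 : (2:ℝ) ^ l * ‖(latticePoint l n - latticePoint l n') i‖ = |(n i : ℝ) - n' i| := by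
    simp only [latticePoint, PiLp.sub_apply, PiLp.smul_apply, smul_eq_mul, ← mul_sub, norm_mul,
      norm_inv, norm_pow, Real.norm_ofNat, Real.norm_eq_abs]
    field_simp
  have h3 : (1:ℝ) ≤ |(n i : ℝ) - n' i| := by
    have : (1:ℤ) ≤ |(n i : ℤ) - n' i| := Int.one_le_abs (by omega)
    exact_mod_cast this
  calc (1:ℝ) ≤ 2 ^ l * ‖(latticePoint l n - latticePoint l n') i‖ := by rw [h2]; exact h3
    _ ≤ _ := by gcongr

/-- Labels of packets: a level `i`, and a lattice point of mesh `2^{-L(i+1)}` in the unit cube. -/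
abbrev PacketIndex (d L : ℕ) : Type :=
  Σ i : Fin (2 ^ (L * d)), (Fin d → Fin (2 ^ (L * (i.val + 1))))

namespace PacketIndex

/-- The scale of the lattice. -/
def coarse {d L : ℕ} (t : PacketIndex d L) : ℕ := L * (t.1.val + 1)

/-- The scale of the packet. -/
def fine {d L : ℕ} (t : PacketIndex d L) : ℕ := L * (t.1.val + 2)

/-- The lattice point. -/
def center {d L : ℕ} (t : PacketIndex d L) : RD d := latticePoint t.coarse fun i => (t.2 i).val

/-- The ball in which the centre of the packet is chosen. -/
def cell {d L : ℕ} (t : PacketIndex d L) : Set (RD d) := kernelBall 0 (1 / 4) t.coarse t.center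

lemma fine_eq {d L : ℕ} (t : PacketIndex d L) : t.fine = t.coarse + L := by
  simp only [fine, coarse]; ring

lemma mem_cell {d L : ℕ} {t : PacketIndex d L} {y : RD d} :
    y ∈ t.cell ↔ 2 ^ t.coarse * ‖y - t.center‖ < 1 / 4 := by
  simp [cell, kernelBall, norm_smul]

lemma norm_le_of_mem_cell {d L : ℕ} {t : PacketIndex d L} {y : RD d} (hy : y ∈ t.cell) :
    ‖y‖ ≤ d + 1 := by
  rw [mem_cell] at hy
  have h1 : ‖t.center‖ ≤ d := norm_latticePoint_le fun i => (t.2 i).isLt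
  have h2 : ‖y‖ ≤ ‖t.center‖ + ‖y - t.center‖ := by
    simpa using norm_add_le t.center (y - t.center)
  have h3 : (1:ℝ) ≤ 2 ^ t.coarse := one_le_pow₀ one_le_two
  nlinarith [norm_nonneg (y - t.center)]

lemma le_norm_center_sub {d L : ℕ} {i : Fin (2 ^ (L * d))}
    {n n' : Fin d → Fin (2 ^ (L * (i.val + 1)))} (h : n ≠ n') :
    1 ≤ (2:ℝ) ^ (L * (i.val + 1)) *
      ‖center (⟨i, n⟩ : PacketIndex d L) - center (⟨i, n'⟩ : PacketIndex d L)‖ := by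
  refine le_norm_latticePoint_sub fun heq => h ?_
  ext j
  exact congrFun heq j

lemma disjoint_cell {d L : ℕ} {i : Fin (2 ^ (L * d))}
    {n n' : Fin d → Fin (2 ^ (L * (i.val + 1)))} (h : n ≠ n') :
    Disjoint (cell (⟨i, n⟩ : PacketIndex d L)) (cell (⟨i, n'⟩ : PacketIndex d L)) := by
  rw [Set.disjoint_left]
  intro x hx hx'
  rw [mem_cell] at hx hx'
  have h1 := le_norm_center_sub (d := d) (L := L) h
  set z := center (⟨i, n⟩ : PacketIndex d L)
  set z' := center (⟨i, n'⟩ : PacketIndex d L)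
  simp only [coarse] at hx hx'
  have h2 : ‖z - z'‖ ≤ ‖x - z'‖ + ‖x - z‖ := by
    have := norm_sub_le (x - z') (x - z)
    rwa [sub_sub_sub_cancel_left] at this
  have h3 := mul_le_mul_of_nonneg_left h2 (by positivity : (0:ℝ) ≤ 2 ^ (L * (i.val + 1)))
  linarith

end PacketIndex

lemma ofReal_inv_two_pow (l d : ℕ) :
    ENNReal.ofReal (((2:ℝ) ^ l) ^ d)⁻¹ = ((2:ℝ≥0∞) ^ (l * d))⁻¹ := by
  rw [ENNReal.ofReal_inv_of_pos (by positivity), ← pow_mul, ENNReal.ofReal_pow two_pos.le]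
  simp

/-- The mean over all cells of the sum of the packet weights is bounded independently of `L`. -/
lemma sum_cell_average_le {d : ℕ} (a : ℝ) (L : ℕ) (x : RD d) :
    ∑ t : PacketIndex d L, 2 * ((volume t.cell)⁻¹ *
        ∫⁻ z in t.cell, ENNReal.ofReal (decayWeight a t.fine z x)) ≤
      2 * ((volume (Metric.ball (0 : RD d) (1 / 4)))⁻¹ *
        ∫⁻ x : RD d, ENNReal.ofReal ((1 + ‖x‖) ^ (-a))) := by
  set V := volume (Metric.ball (0 : RD d) (1 / 4)) with hV
  set I := ∫⁻ x : RD d, ENNReal.ofReal ((1 + ‖x‖) ^ (-a)) with hI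
  have hVt : V ≠ ⊤ := measure_ball_lt_top.ne
  have hpow : ∀ n : ℕ, (2:ℝ≥0∞) ^ n ≠ 0 := fun n => by simp
  have hpowt : ∀ n : ℕ, (2:ℝ≥0∞) ^ n ≠ ⊤ := fun n => by simp
  have hlevel : ∀ i : Fin (2 ^ (L * d)),
      ∑ n : Fin d → Fin (2 ^ (L * (i.val + 1))), 2 * ((volume
        (PacketIndex.cell (⟨i, n⟩ : PacketIndex d L)))⁻¹ *
          ∫⁻ z in PacketIndex.cell (⟨i, n⟩ : PacketIndex d L),
            ENNReal.ofReal (decayWeight a (PacketIndex.fine (⟨i, n⟩ : PacketIndex d L)) z x)) ≤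
        ((2:ℝ≥0∞) ^ (L * d))⁻¹ * (2 * (V⁻¹ * I)) := by
    intro i
    set l := L * (i.val + 1) with hl
    have hvol : ∀ n, volume (PacketIndex.cell (⟨i, n⟩ : PacketIndex d L)) =
        ((2:ℝ≥0∞) ^ (l * d))⁻¹ * V := fun n => by
      rw [PacketIndex.cell, volume_kernelBall, ofReal_inv_two_pow]; rfl
    have hfine : ∀ n, PacketIndex.fine (⟨i, n⟩ : PacketIndex d L) = l + L := fun n =>
      PacketIndex.fine_eq _
    simp only [hvol, hfine]
    rw [← Finset.mul_sum, ← Finset.mul_sum, ← lintegral_biUnion_finset]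
    · calc _ ≤ 2 * ((((2:ℝ≥0∞) ^ (l * d))⁻¹ * V)⁻¹ *
            ∫⁻ z, ENNReal.ofReal (decayWeight a (l + L) z x)) := by
              gcongr; exact Measure.restrict_le_self
        _ = 2 * ((((2:ℝ≥0∞) ^ (l * d))⁻¹ * V)⁻¹ * (((2:ℝ≥0∞) ^ ((l + L) * d))⁻¹ * I)) := by
              simp only [decayWeight_comm a (l + L) _ x]
              rw [lintegral_decayWeight, ofReal_inv_two_pow]
        _ = ((2:ℝ≥0∞) ^ (l * d) * ((2:ℝ≥0∞) ^ (l * d))⁻¹) *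
              (((2:ℝ≥0∞) ^ (L * d))⁻¹ * (2 * (V⁻¹ * I))) := by
              rw [add_mul, pow_add, ENNReal.mul_inv (by simp) (by simp),
                ENNReal.mul_inv (by simp) (by simp), inv_inv]
              ring
        _ = _ := by rw [ENNReal.mul_inv_cancel (hpow _) (hpowt _), one_mul]
    · intro n _ n' _ hne
      exact PacketIndex.disjoint_cell hne
    · exact fun n _ => measurableSet_kernelBall _ _ _ _
  rw [Fintype.sum_sigma]
  refine (Finset.sum_le_sum fun i _ => hlevel i).trans (le_of_eq ?_)
  rw [Finset.sum_const, Finset.card_univ, Fintype.card_fin, nsmul_eq_mul, ← mul_assoc]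
  push_cast
  rw [ENNReal.mul_inv_cancel (hpow _) (hpowt _), one_mul]

lemma decayWeight_add_le {d : ℕ} {a₁ a₂ R : ℝ} (ha₂ : 0 ≤ a₂) (k : ℕ) {y : RD d} (hy : ‖y‖ ≤ R)
    (x : RD d) : decayWeight (a₁ + a₂) k y x ≤
      (R + 1) ^ a₂ * (1 + ‖x‖) ^ (-a₂) * decayWeight a₁ k y x := by
  have hR : 0 ≤ R := (norm_nonneg y).trans hy
  have h2 : (1:ℝ) ≤ 2 ^ k := one_le_pow₀ one_le_two
  set w := 1 + 2 ^ k * ‖x - y‖ with hw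
  have hw1 : 1 ≤ w := by rw [hw]; linarith [(by positivity : 0 ≤ 2 ^ k * ‖x - y‖)]
  have hx : 1 + ‖x‖ ≤ (R + 1) * w := by
    have : ‖x‖ ≤ ‖x - y‖ + ‖y‖ := by simpa using norm_add_le (x - y) y
    nlinarith [norm_nonneg (x - y), norm_nonneg y, mul_nonneg hR (sub_nonneg.2 hw1)]
  have hkey : w ^ (-a₂) ≤ (R + 1) ^ a₂ * (1 + ‖x‖) ^ (-a₂) := by
    rw [Real.rpow_neg (by linarith), Real.rpow_neg (by positivity), ← div_eq_mul_inv,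
      le_div_iff₀ (by positivity), inv_mul_le_iff₀ (by positivity), mul_comm,
      ← Real.mul_rpow (by positivity) (by positivity)]
    exact Real.rpow_le_rpow (by positivity) hx ha₂
  calc decayWeight (a₁ + a₂) k y x = w ^ (-a₂) * decayWeight a₁ k y x := by
        rw [decayWeight, decayWeight, ← hw, ← Real.rpow_add (by positivity)]; ring_nf
    _ ≤ _ := by gcongr; exact decayWeight_nonneg _ _ _ _

/-- Centres can be chosen in the cells so that the packets do not pile up, uniformly in `L`. -/
lemma exists_centers {d : ℕ} {a₁ a₂ r : ℝ} (ha₁ : (d:ℝ) < a₁) (ha₂ : 0 ≤ a₂) (hr : 0 ≤ r)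
    (har : (d:ℝ) < a₂ * r) : ∃ B : ℝ≥0∞, B ≠ ⊤ ∧ ∀ L : ℕ, ∃ y : PacketIndex d L → RD d,
      (∀ t, y t ∈ t.cell) ∧
        ∫⁻ x, (∑ t, ENNReal.ofReal (decayWeight (a₁ + a₂) t.fine (y t) x)) ^ r ≤ B := by
  obtain ⟨Cr, hCr, hexp⟩ := exists_rpow_le_exp r hr
  set A : ℝ≥0∞ := 2 * ((volume (Metric.ball (0 : RD d) (1 / 4)))⁻¹ *
    ∫⁻ x : RD d, ENNReal.ofReal ((1 + ‖x‖) ^ (-a₁))) with hA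
  have hAt : A ≠ ⊤ := ENNReal.mul_ne_top (by simp) (ENNReal.mul_ne_top
    (ENNReal.inv_ne_top.2 (Metric.measure_ball_pos _ _ (by norm_num)).ne')
    (lintegral_one_add_norm_lt_top ha₁).ne)
  set c : ℝ := ((d:ℝ) + 1 + 1) ^ a₂ with hc
  have hc0 : 0 ≤ c := by positivity
  set g : RD d → ℝ≥0∞ := fun x => ENNReal.ofReal (c ^ r * Cr * (1 + ‖x‖) ^ (-(a₂ * r))) with hg
  have hgm : Measurable g := by
    refine ENNReal.measurable_ofReal.comp ?_
    fun_prop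
  refine ⟨(∫⁻ x, g x) * ENNReal.ofReal (Real.exp A.toReal), ?_, fun L => ?_⟩
  · refine ENNReal.mul_ne_top ?_ ENNReal.ofReal_ne_top
    simp only [hg, ENNReal.ofReal_mul (by positivity : 0 ≤ c ^ r * Cr)]
    rw [lintegral_const_mul' _ _ ENNReal.ofReal_ne_top]
    exact ENNReal.mul_ne_top ENNReal.ofReal_ne_top (lintegral_one_add_norm_lt_top har).ne
  · set G : PacketIndex d L → RD d → RD d → ℝ≥0∞ := fun t z x =>
      ENNReal.ofReal (Real.exp (decayWeight a₁ t.fine z x)) with hG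
    have hGm : ∀ t, Measurable (Function.uncurry (G t)) := fun t =>
      (ENNReal.measurable_ofReal.comp (Real.measurable_exp.comp
        (continuous_decayWeight a₁ t.fine).measurable))
    have hvol : ∀ t : PacketIndex d L, volume t.cell ≠ 0 ∧ volume t.cell ≠ ⊤ := by
      intro t
      rw [PacketIndex.cell, volume_kernelBall, ofReal_inv_two_pow]
      exact ⟨mul_ne_zero (by simp) (Metric.measure_ball_pos _ _ (by norm_num)).ne',
        ENNReal.mul_ne_top (by simp) measure_ball_lt_top.ne⟩
    obtain ⟨y, hy, hle⟩ := exists_prod_le_laverage (μ := (volume : Measure (RD d))) Finset.univ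
      (fun t => (hvol t).1) (fun t => (hvol t).2) hGm hgm
    refine ⟨y, hy, ?_⟩
    calc _ ≤ ∫⁻ x, g x * ∏ t, G t (y t) x := by
          refine lintegral_mono fun x => ?_
          have hS0 : 0 ≤ ∑ t, decayWeight a₁ t.fine (y t) x :=
            Finset.sum_nonneg fun t _ => decayWeight_nonneg _ _ _ _
          simp only [hG, hg]
          rw [← ENNReal.ofReal_sum_of_nonneg fun t _ => decayWeight_nonneg _ _ _ _,
            ENNReal.ofReal_rpow_of_nonneg
              (Finset.sum_nonneg fun t _ => decayWeight_nonneg _ _ _ _) hr,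
            ← ENNReal.ofReal_prod_of_nonneg fun _ _ => (Real.exp_pos _).le, ← Real.exp_sum,
            ← ENNReal.ofReal_mul (by positivity)]
          refine ENNReal.ofReal_le_ofReal ?_
          calc (∑ t, decayWeight (a₁ + a₂) t.fine (y t) x) ^ r
              ≤ (∑ t, c * (1 + ‖x‖) ^ (-a₂) * decayWeight a₁ t.fine (y t) x) ^ r := by
                refine Real.rpow_le_rpow (Finset.sum_nonneg fun t _ => decayWeight_nonneg _ _ _ _)
                  (Finset.sum_le_sum fun t _ => ?_) hr
                exact decayWeight_add_le ha₂ _ (PacketIndex.norm_le_of_mem_cell (hy t)) x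
            _ = c ^ r * (1 + ‖x‖) ^ (-(a₂ * r)) *
                (∑ t, decayWeight a₁ t.fine (y t) x) ^ r := by
                rw [← Finset.mul_sum, Real.mul_rpow (by positivity) hS0,
                  Real.mul_rpow hc0 (by positivity),
                  ← Real.rpow_mul (by positivity : (0:ℝ) ≤ 1 + ‖x‖), neg_mul]
            _ ≤ c ^ r * (1 + ‖x‖) ^ (-(a₂ * r)) *
                (Cr * Real.exp (∑ t, decayWeight a₁ t.fine (y t) x)) := by
                gcongr; exact hexp _ hS0
            _ = _ := by ring
      _ ≤ _ := hle
      _ ≤ ∫⁻ x, g x * ENNReal.ofReal (Real.exp A.toReal) := by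
          refine lintegral_mono fun x => ?_
          gcongr
          refine le_trans (Finset.prod_le_prod' fun t _ => ?_)
            (prod_one_add_le_exp Finset.univ ENNReal.toReal_nonneg
              (by rw [ENNReal.ofReal_toReal hAt]; exact sum_cell_average_le a₁ L x))
          rw [setLAverage_eq, ENNReal.div_eq_inv_mul]
          calc _ ≤ (volume t.cell)⁻¹ * ∫⁻ z in t.cell,
                (1 + 2 * ENNReal.ofReal (decayWeight a₁ t.fine z x)) := by
                gcongr with z
                have h0 := decayWeight_nonneg a₁ t.fine z x
                have h1 := decayWeight_le_one (ha₁.le.trans' (by positivity)) t.fine z x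
                have h2 : Real.exp (decayWeight a₁ t.fine z x) ≤
                    1 + 2 * decayWeight a₁ t.fine z x := by
                  have := Real.abs_exp_sub_one_le (x := decayWeight a₁ t.fine z x)
                    (by rwa [abs_of_nonneg h0])
                  rw [abs_of_nonneg h0] at this
                  linarith [le_abs_self (Real.exp (decayWeight a₁ t.fine z x) - 1)]
                simp only [hG]
                refine (ENNReal.ofReal_le_ofReal h2).trans (le_of_eq ?_)
                rw [ENNReal.ofReal_add zero_le_one (by positivity), ENNReal.ofReal_mul two_pos.le]
                simp
            _ = _ := by
                rw [lintegral_add_left measurable_const, lintegral_const_mul' _ _ (by simp),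
                  mul_add]
                simp only [lintegral_const, one_mul, MeasurableSet.univ, Measure.restrict_apply,
                  Set.univ_inter]
                rw [ENNReal.inv_mul_cancel (hvol t).1 (hvol t).2]
                ring
      _ = _ := lintegral_mul_const _ hgm

/-! ### Random signs -/

/-- The sign attached to a boolean. -/
def boolSign (b : Bool) : ℂ := if b then 1 else -1

lemma norm_boolSign (b : Bool) : ‖boolSign b‖ = 1 := by cases b <;> simp [boolSign]

lemma card_mul_rpow_le_sum_signs {ι : Type*} [Fintype ι] [DecidableEq ι] (z : ι → ℂ) {Q : ℝ}
    (hQ : 0 ≤ Q) (hQ1 : Q ≤ 1) (t₀ : ι) :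
    Fintype.card (ι → Bool) * ‖z t₀‖ₑ ^ Q ≤
      2 * ∑ ε : ι → Bool, ‖∑ t, boolSign (ε t) * z t‖ₑ ^ Q := by
  set F : (ι → Bool) → ℂ := fun ε => ∑ t, boolSign (ε t) * z t with hF
  have hinv : Function.Involutive fun ε : ι → Bool => Function.update ε t₀ (!ε t₀) := by
    intro ε; simp
  set e := hinv.toPerm with he
  have hdiff : ∀ ε, F ε - F (e ε) = 2 * (boolSign (ε t₀) * z t₀) := by
    intro ε
    simp only [hF, ← Finset.sum_sub_distrib]
    rw [Finset.sum_eq_single t₀]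
    · have : e ε t₀ = !ε t₀ := by simp [he]
      rw [this]
      cases ε t₀ <;> simp [boolSign] <;> ring
    · intro t _ ht
      have : e ε t = ε t := by simp [he, ht]
      rw [this, sub_self]
    · simp
  have hpair : ∀ ε, ‖z t₀‖ₑ ^ Q ≤ ‖F ε‖ₑ ^ Q + ‖F (e ε)‖ₑ ^ Q := by
    intro ε
    refine le_trans (ENNReal.rpow_le_rpow ?_ hQ) (ENNReal.rpow_add_le_add_rpow _ _ hQ hQ1)
    refine le_trans ?_ enorm_sub_le
    rw [hdiff]
    refine enorm_le_iff_norm_le.2 ?_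
    rw [norm_mul, norm_mul, norm_boolSign, one_mul]
    simp only [Complex.norm_ofNat]
    linarith [norm_nonneg (z t₀)]
  calc (Fintype.card (ι → Bool) : ℝ≥0∞) * ‖z t₀‖ₑ ^ Q = ∑ _ε : ι → Bool, ‖z t₀‖ₑ ^ Q := by
        rw [Finset.sum_const, Finset.card_univ, nsmul_eq_mul]
    _ ≤ ∑ ε, (‖F ε‖ₑ ^ Q + ‖F (e ε)‖ₑ ^ Q) := Finset.sum_le_sum fun ε _ => hpair ε
    _ = 2 * ∑ ε, ‖F ε‖ₑ ^ Q := by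
        rw [Finset.sum_add_distrib, Equiv.sum_comp e fun ε => ‖F ε‖ₑ ^ Q, two_mul]

lemma ofReal_two_rpow_mul_norm (r : ℝ) (w : ℂ) :
    ENNReal.ofReal ((2:ℝ) ^ r * ‖w‖) = ‖(((2:ℝ) ^ r : ℝ) : ℂ) * w‖ₑ := by
  rw [← ofReal_norm, norm_mul, Complex.norm_real, Real.norm_of_nonneg (by positivity)]

/-- Signs can be chosen so that every function dominates on its own set. -/
lemma exists_signs {d : ℕ} (D : LPData d) (s : ℝ) {Q : ℝ} (hQ : 0 ≤ Q) (hQ1 : Q ≤ 1)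
    {ι : Type*} [Fintype ι] [DecidableEq ι] (b : ι → ℂ) (g : ι → 𝓢(RD d, ℂ)) (J : ι → Finset ℕ)
    (W : ι → ℕ → Set (RD d)) (hW : ∀ t j, MeasurableSet (W t j)) {U : Set (RD d)}
    (hU : ∀ t, ∀ j ∈ J t, W t j ⊆ U)
    (hdisj : ∀ j t t', t ≠ t' → j ∈ J t → j ∈ J t' → Disjoint (W t j) (W t' j)) :
    ∃ ε : ι → Bool, ∑ t, ∑ j ∈ J t, ∫⁻ x in W t j,
        ENNReal.ofReal ((2:ℝ) ^ (s * ((j:ℝ) + 1)) * ‖b t * LP D (j + 1) (g t) x‖) ^ Q ≤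
      2 * ∫⁻ x in U, ∑' j, lpTerm D s (∑ t, (boolSign (ε t) * b t) • g t : 𝓢(RD d, ℂ)) j x ^ Q := by
  set H : (ι → Bool) → 𝓢(RD d, ℂ) := fun ε => ∑ t, (boolSign (ε t) * b t) • g t with hH
  have hmeas : ∀ ε j, Measurable fun x => lpTerm D s (H ε) j x ^ Q := fun ε j =>
    (measurable_lpTerm D s (H ε) j).pow_const Q
  have hupper : ∀ ε, ∑ t, ∑ j ∈ J t, ∫⁻ x in W t j, lpTerm D s (H ε) j x ^ Q ≤
      ∫⁻ x in U, ∑' j, lpTerm D s (H ε) j x ^ Q := by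
    intro ε
    rw [Finset.sum_comm' (t' := Finset.univ.biUnion J)
      (s' := fun j => Finset.univ.filter fun t => j ∈ J t) (by simp; tauto)]
    calc _ ≤ ∑ j ∈ Finset.univ.biUnion J, ∫⁻ x in U, lpTerm D s (H ε) j x ^ Q := by
          refine Finset.sum_le_sum fun j _ => ?_
          rw [← lintegral_biUnion_finset]
          · refine lintegral_mono_set (Set.iUnion₂_subset fun t ht => hU t j ?_)
            simpa using ht
          · intro t ht t' ht' hne
            exact hdisj j t t' hne (by simpa using ht) (by simpa using ht')
          · exact fun t _ => hW t j
      _ = ∫⁻ x in U, ∑ j ∈ Finset.univ.biUnion J, lpTerm D s (H ε) j x ^ Q :=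
          (lintegral_finsetSum _ fun j _ => hmeas ε j).symm
      _ ≤ _ := lintegral_mono fun x => ENNReal.sum_le_tsum _
  obtain ⟨X, hX⟩ : ∃ X, X = ∑ t, ∑ j ∈ J t, ∫⁻ x in W t j,
    ENNReal.ofReal ((2:ℝ) ^ (s * ((j:ℝ) + 1)) * ‖b t * LP D (j + 1) (g t) x‖) ^ Q := ⟨_, rfl⟩
  rw [← hX]
  have hsum : ∑ _ε : ι → Bool, X ≤
      ∑ ε, 2 * ∑ t, ∑ j ∈ J t, ∫⁻ x in W t j, lpTerm D s (H ε) j x ^ Q := by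
    rw [← Finset.mul_sum, Finset.sum_comm, Finset.mul_sum, Finset.sum_const, Finset.card_univ,
      nsmul_eq_mul, hX, Finset.mul_sum]
    refine Finset.sum_le_sum fun t _ => ?_
    rw [Finset.sum_comm, Finset.mul_sum, Finset.mul_sum]
    refine Finset.sum_le_sum fun j _ => ?_
    rw [← lintegral_finsetSum _ fun ε _ => hmeas ε j,
      ← lintegral_const_mul' _ _ (ENNReal.natCast_ne_top _),
      ← lintegral_const_mul' _ _ (by simp)]
    refine lintegral_mono fun x => ?_
    have h := card_mul_rpow_le_sum_signs (fun t => (((2:ℝ) ^ (s * ((j:ℝ) + 1)) : ℝ) : ℂ) *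
      (b t * LP D (j + 1) (g t) x)) hQ hQ1 t
    rw [ofReal_two_rpow_mul_norm]
    refine h.trans (le_of_eq ?_)
    congr 1
    refine Finset.sum_congr rfl fun ε _ => ?_
    rw [lpTerm, hH, LP_sum, ofReal_two_rpow_mul_norm, Finset.mul_sum]
    congr 2
    exact Finset.sum_congr rfl fun t _ => by ring
  obtain ⟨ε, -, hε⟩ := ENNReal.exists_le_of_sum_le Finset.univ_nonempty hsum
  exact ⟨ε, hε.trans (by gcongr; exact hupper ε)⟩

/-! ### Many packets with random centres and signs -/

lemma rpow_sum_le_sum_rpow {ι : Type*} (S : Finset ι) (a : ι → ℝ≥0∞) {Q : ℝ} (hQ : 0 < Q)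
    (hQ1 : Q ≤ 1) : (∑ t ∈ S, a t) ^ Q ≤ ∑ t ∈ S, a t ^ Q :=
  Finset.le_sum_of_subadditive (fun x : ℝ≥0∞ => x ^ Q) (ENNReal.zero_rpow_of_pos hQ).le
    (fun x y => ENNReal.rpow_add_le_add_rpow x y hQ.le hQ1) S a

/-- The `ℓ^Q` sum of the pieces of a superposition of normalised packets. -/
lemma exists_tsum_lpTerm_packets_le {d : ℕ} (D : LPData d) (σ : ℝ) (K : ℕ) {Q : ℝ} (hQ : 0 < Q)
    (hQ1 : Q ≤ 1) : ∃ C : ℝ≥0∞, C ≠ ⊤ ∧ ∀ u : RD d, ‖u‖ = 1 → ∀ (ι : Type) [Fintype ι] (c : ι → ℂ)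
      (k : ι → ℕ) (y : ι → RD d), (∀ t, ‖c t‖ = (2:ℝ) ^ (-(k t * (σ + d)) : ℝ)) → ∀ x,
      ∑' j, lpTerm D σ (∑ t, c t • packet ((2:ℝ) ^ k t • u) (k t) (y t) : 𝓢(RD d, ℂ)) j x ^ Q ≤
        C * ∑ t, ENNReal.ofReal (decayWeight (K * Q) (k t) (y t) x) := by
  obtain ⟨C, hC, hbound⟩ := exists_packet_term_bound D σ K
  refine ⟨3 * ENNReal.ofReal C ^ Q, ENNReal.mul_ne_top (by simp)
    (ENNReal.rpow_ne_top_of_nonneg hQ.le ENNReal.ofReal_ne_top), fun u hu ι _ c k y hc x => ?_⟩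
  set A : ι → ℕ → ℝ≥0∞ := fun t j => ENNReal.ofReal ((2:ℝ) ^ (σ * ((j:ℝ) + 1)) *
    ‖c t * LP D (j + 1) (packet ((2:ℝ) ^ k t • u) (k t) (y t)) x‖) with hA
  have hAbound : ∀ t j, A t j ≤ ENNReal.ofReal (C * decayWeight K (k t) (y t) x) := by
    intro t j
    refine ENNReal.ofReal_le_ofReal ?_
    have h1 := hbound u hu (k t) (k t) j (y t) x le_rfl
    rw [norm_mul, hc t]
    calc _ = (2:ℝ) ^ (-(k t * (σ + d)) : ℝ) * ((2:ℝ) ^ (σ * ((j:ℝ) + 1)) *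
          ‖LP D (j + 1) (packet ((2:ℝ) ^ k t • u) (k t) (y t)) x‖) := by ring
      _ ≤ (2:ℝ) ^ (-(k t * (σ + d)) : ℝ) *
          (C * (2:ℝ) ^ (σ * k t + k t * d) * decayWeight K (k t) (y t) x) := by gcongr
      _ = ((2:ℝ) ^ (-(k t * (σ + d)) : ℝ) * (2:ℝ) ^ (σ * k t + k t * d)) *
          (C * decayWeight K (k t) (y t) x) := by ring
      _ = C * decayWeight K (k t) (y t) x := by
          rw [← Real.rpow_add two_pos]; ring_nf; simp
  have hAzero : ∀ t, ∀ j ∉ Finset.Icc (k t - 2) (k t), A t j = 0 := by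
    intro t j hj
    rw [Finset.mem_Icc] at hj
    simp only [hA]
    rw [LP_packet_eq_zero D hu le_rfl (by omega)]
    simp
  calc _ ≤ ∑' j, ∑ t, A t j ^ Q := by
        refine ENNReal.tsum_le_tsum fun j => ?_
        refine le_trans (ENNReal.rpow_le_rpow ?_ hQ.le)
          (rpow_sum_le_sum_rpow Finset.univ (fun t => A t j) hQ hQ1)
        rw [lpTerm, LP_sum, ← ENNReal.ofReal_sum_of_nonneg fun t _ => by positivity,
          ← Finset.mul_sum]
        refine ENNReal.ofReal_le_ofReal ?_
        gcongr
        exact norm_sum_le _ _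
    _ = ∑ t, ∑' j, A t j ^ Q := Summable.tsum_finsetSum fun _ _ => ENNReal.summable
    _ ≤ ∑ t, 3 * (ENNReal.ofReal C ^ Q *
          ENNReal.ofReal (decayWeight (K * Q) (k t) (y t) x)) := by
        refine Finset.sum_le_sum fun t _ => ?_
        rw [tsum_eq_sum (s := Finset.Icc (k t - 2) (k t)) fun j hj => by
          rw [hAzero t j hj, ENNReal.zero_rpow_of_pos hQ]]
        refine (Finset.sum_le_card_nsmul _ _ (ENNReal.ofReal C ^ Q *
          ENNReal.ofReal (decayWeight (K * Q) (k t) (y t) x)) fun j _ => ?_).trans ?_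
        · refine (ENNReal.rpow_le_rpow (hAbound t j) hQ.le).trans (le_of_eq ?_)
          rw [ENNReal.ofReal_mul hC, ENNReal.mul_rpow_of_nonneg _ _ hQ.le,
            ENNReal.ofReal_rpow_of_nonneg (decayWeight_nonneg _ _ _ _) hQ.le, decayWeight_rpow]
        · rw [nsmul_eq_mul]
          gcongr
          simp only [Nat.card_Icc]
          exact_mod_cast (by omega : k t + 1 - (k t - 2) ≤ 3)
    _ = _ := by
        rw [Finset.mul_sum]
        exact Finset.sum_congr rfl fun t _ => by ring

lemma PacketIndex.sum_inv_two_pow_fine (d L : ℕ) :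
    ∑ t : PacketIndex d L, ((2:ℝ≥0∞) ^ (t.fine * d))⁻¹ = 1 := by
  have hpow : ∀ n : ℕ, (2:ℝ≥0∞) ^ n ≠ 0 := fun n => by simp
  have hpowt : ∀ n : ℕ, (2:ℝ≥0∞) ^ n ≠ ⊤ := fun n => by simp
  rw [Fintype.sum_sigma]
  calc _ = ∑ _i : Fin (2 ^ (L * d)), ((2:ℝ≥0∞) ^ (L * d))⁻¹ := by
        refine Finset.sum_congr rfl fun i _ => ?_
        simp only [PacketIndex.fine_eq, PacketIndex.coarse, Finset.sum_const, Finset.card_univ,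
          Fintype.card_pi, Fintype.card_fin, Finset.prod_const, nsmul_eq_mul]
        push_cast
        rw [add_mul, pow_add, ENNReal.mul_inv (by simp) (by simp), ← pow_mul, ← mul_assoc,
          ENNReal.mul_inv_cancel (hpow _) (hpowt _), one_mul]
    _ = 1 := by
        rw [Finset.sum_const, Finset.card_univ, Fintype.card_fin, nsmul_eq_mul]
        push_cast
        exact ENNReal.mul_inv_cancel (hpow _) (hpowt _)

/-- Kernel balls at scales finer than the lattice stay close to the centre of the packet. -/
lemma two_pow_mul_norm_lt_of_mem_kernelBall {d l R j : ℕ} {x₀ : RD d} {ρ : ℝ}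
    (hR : ‖x₀‖ + ρ ≤ 2 ^ R) (hj : l + R + 1 ≤ j) {x y : RD d} (hx : x ∈ kernelBall x₀ ρ (j + 1) y) :
    2 ^ l * ‖x - y‖ < 1 / 4 := by
  have h1 := (norm_of_mem_kernelBall hx).2.trans_le hR
  have h2 : (2:ℝ) ^ (l + R + 2) ≤ 2 ^ (j + 1) := pow_le_pow_right₀ one_le_two (by omega)
  have h3 : (2:ℝ) ^ (l + R + 2) * ‖x - y‖ < 2 ^ R :=
    (mul_le_mul_of_nonneg_right h2 (norm_nonneg _)).trans_lt h1
  have h4 : (2:ℝ) ^ (l + R + 2) * ‖x - y‖ = 2 ^ R * (4 * (2 ^ l * ‖x - y‖)) := by ring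
  rw [h4] at h3
  have := lt_of_mul_lt_mul_left (h3.trans_eq (mul_one _).symm) (by positivity)
  linarith

lemma disjoint_packet_kernelBall {d L R j : ℕ} {x₀ : RD d} {ρ : ℝ} (hR : ‖x₀‖ + ρ ≤ 2 ^ R)
    {y : PacketIndex d L → RD d} (hy : ∀ t, y t ∈ t.cell) {t t' : PacketIndex d L} (hne : t ≠ t')
    (hj : j ∈ Finset.Ico (t.coarse + R + 1) t.fine)
    (hj' : j ∈ Finset.Ico (t'.coarse + R + 1) t'.fine) :
    Disjoint (kernelBall x₀ ρ (j + 1) (y t)) (kernelBall x₀ ρ (j + 1) (y t')) := by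
  rw [Finset.mem_Ico] at hj hj'
  obtain ⟨i, n⟩ := t
  obtain ⟨i', n'⟩ := t'
  have hlevel : ∀ a b : ℕ, a < b → L * (a + 2) ≤ L * (b + 1) := fun a b hab =>
    Nat.mul_le_mul_left L (by omega)
  have hi : i = i' := by
    ext
    simp only [PacketIndex.coarse, PacketIndex.fine] at hj hj'
    rcases lt_trichotomy i.val i'.val with h | h | h
    · have := hlevel _ _ h; omega
    · exact h
    · have := hlevel _ _ h; omega
  subst hi
  have hnn : n ≠ n' := fun h => hne (by rw [h])
  rw [Set.disjoint_left]
  intro x hx hx'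
  have h1 := two_pow_mul_norm_lt_of_mem_kernelBall hR hj.1 hx
  have h1' := two_pow_mul_norm_lt_of_mem_kernelBall hR hj'.1 hx'
  have h2 := PacketIndex.mem_cell.1 (hy ⟨i, n⟩)
  have h2' := PacketIndex.mem_cell.1 (hy ⟨i, n'⟩)
  have h3 := PacketIndex.le_norm_center_sub (d := d) (L := L) hnn
  simp only [PacketIndex.coarse] at h1 h1' h2 h2'
  set z := PacketIndex.center (⟨i, n⟩ : PacketIndex d L)
  set z' := PacketIndex.center (⟨i, n'⟩ : PacketIndex d L)
  have h4 : ‖z - z'‖ ≤ (‖x - y ⟨i, n'⟩‖ + ‖y ⟨i, n'⟩ - z'‖) +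
      (‖x - y ⟨i, n⟩‖ + ‖y ⟨i, n⟩ - z‖) := by
    have e : z - z' = ((x - y ⟨i, n'⟩) + (y ⟨i, n'⟩ - z')) -
      ((x - y ⟨i, n⟩) + (y ⟨i, n⟩ - z)) := by abel
    rw [e]
    exact (norm_sub_le _ _).trans (add_le_add (norm_add_le _ _) (norm_add_le _ _))
  have h5 := mul_le_mul_of_nonneg_left h4 (by positivity : (0:ℝ) ≤ 2 ^ (L * (i.val + 1)))
  linarith

lemma le_one_add_rpow {r : ℝ} (hr : 1 ≤ r) (a : ℝ≥0∞) : a ≤ 1 + a ^ r := by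
  rcases le_total a 1 with h | h
  · exact h.trans le_self_add
  · calc a = a ^ (1:ℝ) := (ENNReal.rpow_one a).symm
      _ ≤ a ^ r := ENNReal.rpow_le_rpow_of_exponent_le h hr
      _ ≤ _ := le_add_self

lemma ellNorm_rpow {p q : ℝ≥0∞} (hq : q ≠ ⊤) (A : ℕ → ℝ≥0∞) :
    ellNorm q A ^ p.toReal = (∑' j, A j ^ q.toReal) ^ (p.toReal / q.toReal) := by
  rw [ellNorm, if_neg hq, ← ENNReal.rpow_mul]; ring_nf

/-- If `q ≤ 1`, `q ≤ p < ∞` and `(s + d) q ≤ d`, a superposition of packets at many scales shows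
unboundedness. -/
lemma unbounded_of_many_packets {d : ℕ} (D : LPData d) {u : RD d} (hu : ‖u‖ = 1) (m s : ℝ)
    {p q : ℝ≥0∞} (hp : p ≠ ⊤) (hq : q ≠ 0) (hq1 : q ≤ 1) (hqp : q ≤ p)
    (hs : (s + d) * q.toReal ≤ d) (C : ℝ≥0) : ∃ f : 𝓢(RD d, ℂ),
      (C : ℝ≥0∞) * TLNorm D (s + m) p q f < TLNorm D s p q (pdo (shiftSymbol u m) f) := by
  have hqt : q ≠ ⊤ := (hq1.trans_lt ENNReal.one_lt_top).ne
  have hp0 : p ≠ 0 := fun h => hq (le_zero_iff.1 (h ▸ hqp))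
  obtain ⟨P, hPdef⟩ : ∃ P, P = p.toReal := ⟨_, rfl⟩
  obtain ⟨Q, hQdef⟩ : ∃ Q, Q = q.toReal := ⟨_, rfl⟩
  have hP : 0 < P := hPdef ▸ ENNReal.toReal_pos hp0 hp
  have hQ : 0 < Q := hQdef ▸ ENNReal.toReal_pos hq hqt
  have hQ1 : Q ≤ 1 := by
    rw [hQdef]; exact ENNReal.toReal_le_of_le_ofReal zero_le_one (by simpa using hq1)
  have hr : 1 ≤ P / Q := by
    rw [one_le_div hQ, hPdef, hQdef]; exact ENNReal.toReal_mono hp hqp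
  rw [← hQdef] at hs
  obtain ⟨K, hK⟩ := exists_nat_gt ((2 * d + 1 : ℝ) / Q)
  rw [div_lt_iff₀ hQ] at hK
  obtain ⟨B, hB, hcenters⟩ := exists_centers (d := d) (a₁ := d + 1) (a₂ := K * Q - (d + 1))
    (r := P / Q) (by linarith) (by have : (0:ℝ) ≤ d := by positivity
                                   linarith) (by positivity)
    (by have : (0:ℝ) ≤ d := by positivity
        nlinarith)
  rw [add_sub_cancel] at hcenters
  obtain ⟨C₁, hC₁, hinput⟩ := exists_tsum_lpTerm_packets_le D (s + m) K hQ hQ1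
  obtain ⟨x₀, ρ, c, hρ, h8, hc, hφ⟩ := exists_kernel_lower D hu
  obtain ⟨R, hR⟩ := pow_unbounded_of_one_lt (‖x₀‖ + ρ) (one_lt_two (α := ℝ))
  obtain ⟨v, hv⟩ : ∃ v, v = ENNReal.ofReal (c ^ Q) * volume (Metric.ball x₀ ρ) := ⟨_, rfl⟩
  have hv0 : v ≠ 0 := by
    rw [hv]
    exact mul_ne_zero (by simpa using Real.rpow_pos_of_pos hc Q)
      (Metric.measure_ball_pos _ _ hρ).ne'
  obtain ⟨U, hU⟩ : ∃ U : Set (RD d), U = Metric.closedBall 0 (d + 2) := ⟨_, rfl⟩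
  have hUt : volume U ≠ ⊤ := hU ▸ measure_closedBall_lt_top.ne
  obtain ⟨B', hB'⟩ : ∃ B', B' = C₁ ^ (P / Q) * B := ⟨_, rfl⟩
  have hB't : B' ≠ ⊤ := hB' ▸ ENNReal.mul_ne_top
    (ENNReal.rpow_ne_top_of_nonneg (by positivity) hC₁) hB
  have hCt : (C : ℝ≥0∞) ^ P * B' ≠ ⊤ := ENNReal.mul_ne_top
    (ENNReal.rpow_ne_top_of_nonneg hP.le ENNReal.coe_ne_top) hB't
  obtain ⟨N, hN⟩ := ENNReal.exists_nat_mul_gt hv0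
    (ENNReal.mul_ne_top ENNReal.ofNat_ne_top (ENNReal.add_ne_top.2 ⟨hUt, hCt⟩) :
      2 * (volume U + (C : ℝ≥0∞) ^ P * B') ≠ ⊤)
  obtain ⟨L, hL⟩ : ∃ L, L = N + R + 6 := ⟨_, rfl⟩
  obtain ⟨y, hy, hyB⟩ := hcenters L
  obtain ⟨ε, hε⟩ := exists_signs D s hQ.le hQ1
    (fun t : PacketIndex d L => (((2:ℝ) ^ (-(t.fine * (s + d)) : ℝ) : ℝ) : ℂ))
    (fun t => packet 0 t.fine (y t))
    (fun t => Finset.Ico (t.coarse + R + 1) (t.coarse + R + 1 + N))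
    (fun t j => kernelBall x₀ ρ (j + 1) (y t)) (fun t j => measurableSet_kernelBall _ _ _ _)
    (U := U)
    (fun t j hj x hx => by
      have h1 := two_pow_mul_norm_lt_of_mem_kernelBall hR.le (Finset.mem_Ico.1 hj).1 hx
      have h2 := PacketIndex.norm_le_of_mem_cell (hy t)
      have h3 : ‖x‖ ≤ ‖x - y t‖ + ‖y t‖ := by simpa using norm_add_le (x - y t) (y t)
      have h4 : (1:ℝ) ≤ 2 ^ t.coarse := one_le_pow₀ one_le_two
      rw [hU, mem_closedBall_zero_iff]
      nlinarith [norm_nonneg (x - y t)])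
    (fun j t t' hne hj hj' => by
      rw [Finset.mem_Ico] at hj hj'
      refine disjoint_packet_kernelBall hR.le hy hne ?_ ?_ <;>
        rw [Finset.mem_Ico, PacketIndex.fine_eq] <;> omega)
  set f : 𝓢(RD d, ℂ) := ∑ t : PacketIndex d L,
    (boolSign (ε t) * (((2:ℝ) ^ (-(t.fine * (s + m + d)) : ℝ) : ℝ) : ℂ)) •
      packet ((2:ℝ) ^ t.fine • u) t.fine (y t) with hf
  have hTf : pdo (shiftSymbol u m) f = ⇑(∑ t : PacketIndex d L,
      (boolSign (ε t) * (((2:ℝ) ^ (-(t.fine * (s + d)) : ℝ) : ℝ) : ℂ)) •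
        packet 0 t.fine (y t)) := by
    rw [hf, pdo_sum_packet hu m _ _ _ _ _ fun _ _ => le_rfl]
    simp only [mul_assoc, two_rpow_shift]
  have hfine : ∀ t : PacketIndex d L, t.coarse + R + 1 + N + 5 ≤ t.fine := by
    intro t; rw [PacketIndex.fine_eq]; omega
  refine ⟨f, ?_⟩
  have hin : TLNorm D (s + m) p q f ≤ B' ^ (1 / P) := by
    rw [TLNorm_eq D _ q hp, lpNormFun_zero d hp0 hp, zero_add, ← hPdef]
    · refine ENNReal.rpow_le_rpow ?_ (by positivity)
      simp only [hPdef, ellNorm_rpow hqt]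
      rw [← hPdef, ← hQdef, hB']
      refine le_trans ?_ (mul_le_mul_right hyB (C₁ ^ (P / Q)))
      rw [← lintegral_const_mul' _ _ (ENNReal.rpow_ne_top_of_nonneg (by positivity) hC₁)]
      refine lintegral_mono fun x => ?_
      rw [← ENNReal.mul_rpow_of_nonneg _ _ (by positivity)]
      refine ENNReal.rpow_le_rpow (hinput u hu _ _ _ _ (fun t => ?_) x) (by positivity)
      rw [norm_mul, norm_boolSign, one_mul, Complex.norm_real, Real.norm_of_nonneg (by positivity)]
    · intro x
      rw [hf, LP_sum]
      refine Finset.sum_eq_zero fun t _ => ?_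
      rw [LP_zero_packet_eq_zero D hu le_rfl (by have := hfine t; omega), mul_zero]
  obtain ⟨Y, hY⟩ : ∃ Y, Y = ∫⁻ x, (∑' j, lpTerm D s (pdo (shiftSymbol u m) f) j x ^ Q) ^ (P / Q) :=
    ⟨_, rfl⟩
  have hout : Y ^ (1 / P) ≤ TLNorm D s p q (pdo (shiftSymbol u m) f) := by
    rw [TLNorm_eq D _ q hp]
    refine le_trans (le_of_eq ?_) le_add_self
    simp only [ellNorm_rpow hqt]
    rw [hY, hPdef, hQdef]
  have hlow : N * v ≤ 2 * (volume U + Y) := by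
    calc (N * v : ℝ≥0∞) = ∑ t : PacketIndex d L,
          ∑ _j ∈ Finset.Ico (t.coarse + R + 1) (t.coarse + R + 1 + N),
            ((2:ℝ≥0∞) ^ (t.fine * d))⁻¹ * v := by
          simp only [Finset.sum_const, Nat.card_Ico, add_tsub_cancel_left, nsmul_eq_mul]
          rw [← Finset.mul_sum, ← Finset.sum_mul, PacketIndex.sum_inv_two_pow_fine, one_mul]
      _ ≤ _ := by
          refine Finset.sum_le_sum fun t _ => Finset.sum_le_sum fun j hj => ?_
          have hjt := Finset.mem_Ico.1 hj
          have hft := hfine t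
          refine le_trans (le_of_eq ?_) ((lintegral_kernelBall_ge D hc hφ hQ hs (j := j)
            (k := t.fine) (by omega) (y t)).trans (le_of_eq (lintegral_congr fun x => ?_)))
          · rw [hv, ENNReal.ofReal_mul (by positivity), ← ofReal_inv_two_pow,
              Real.rpow_neg two_pos.le, ← pow_mul, ← mul_assoc]
            congr 4
            exact_mod_cast (Real.rpow_natCast 2 (t.fine * d)).symm
          · rw [LP_packet_zero_eq_kernel D (by omega), norm_mul, Complex.norm_real,
              Real.norm_of_nonneg (by positivity)]
      _ ≤ _ := hε
      _ ≤ 2 * ∫⁻ x in U, (1 + (∑' j, lpTerm D s (pdo (shiftSymbol u m) f) j x ^ Q) ^ (P / Q)) := by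
          rw [hTf]
          gcongr with x
          exact le_one_add_rpow hr _
      _ ≤ _ := by
          rw [lintegral_add_left measurable_const, setLIntegral_const, one_mul, hY]
          gcongr
          exact Measure.restrict_le_self
  have hYlt : (C : ℝ≥0∞) ^ P * B' < Y := by
    by_contra hle
    exact absurd (hN.trans_le hlow) (not_lt.2 (by gcongr; exact not_lt.1 hle))
  calc (C : ℝ≥0∞) * TLNorm D (s + m) p q f ≤ C * B' ^ (1 / P) := by gcongr
    _ = ((C : ℝ≥0∞) ^ P * B') ^ (1 / P) := by
        rw [ENNReal.mul_rpow_of_nonneg _ _ (by positivity), ← ENNReal.rpow_mul,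
          mul_one_div_cancel hP.ne', ENNReal.rpow_one]
    _ < Y ^ (1 / P) := ENNReal.rpow_lt_rpow hYlt (by positivity)
    _ ≤ _ := hout

/-- if `s ≤ τ_{p,q} = d/min(1,p,q) - d` (with `0 < p < ∞` or `p = q = ∞`)
then some `a ∈ S^m_{1,1}` is unbounded from `F_p^{s+m,q}` to `F_p^{s,q}`. -/
theorem statement4 (d : ℕ) (hd : 1 ≤ d) (m : ℝ) (p q : ℝ≥0∞)
    (hp : 0 < p) (hq : 0 < q) (hcase : p < (⊤ : ℝ≥0∞) ∨ (p = (⊤ : ℝ≥0∞) ∧ q = (⊤ : ℝ≥0∞)))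
    (s : ℝ) (hs : s ≤ (d : ℝ) / (min 1 (min p q)).toReal - d)
    (D : LPData d) :
    ∃ a : RD d → RD d → ℂ, IsSymbolS11 d m a ∧
      ∀ C : ℝ≥0, 0 < C → ∃ f : 𝓢(RD d, ℂ),
        (C : ℝ≥0∞) * TLNorm D (s+m) p q (⇑f) < TLNorm D s p q (pdo a f) := by
  set u : RD d := EuclideanSpace.single ⟨0, hd⟩ (1:ℝ) with hu_def
  have hu : ‖u‖ = 1 := by simp [hu_def]
  refine ⟨shiftSymbol u m, isSymbolS11_shiftSymbol hu m, fun C _ => ?_⟩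
  have hscale : ∀ r : ℝ≥0∞, r ≠ 0 → r ≠ ⊤ → min 1 (min p q) = r → (s + d) * r.toReal ≤ d := by
    rintro r hr0 hrt rfl
    have := ENNReal.toReal_pos hr0 hrt
    rw [← le_div_iff₀ this]; linarith
  have hone : min 1 (min p q) = 1 → s ≤ 0 := by
    intro h
    have := hscale 1 one_ne_zero ENNReal.one_ne_top h
    simp only [ENNReal.toReal_one, mul_one] at this
    linarith
  rcases hcase with hpt | ⟨rfl, rfl⟩
  · by_cases hA : p ≤ 1 ∧ p ≤ q
    · refine unbounded_of_single_packet D hu m s hp.ne' hpt.ne hq.ne' (hscale p hp.ne' hpt.ne ?_) C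
      rw [min_eq_left hA.2, min_eq_right hA.1]
    · by_cases hq1 : q ≤ 1
      · have hqp : q ≤ p := by
          by_contra hlt
          exact hA ⟨(not_le.1 hlt).le.trans hq1, (not_le.1 hlt).le⟩
        refine unbounded_of_many_packets D hu m s hpt.ne hq.ne' hq1 hqp
          (hscale q hq.ne' (hq1.trans_lt ENNReal.one_lt_top).ne ?_) C
        rw [min_eq_right hqp, min_eq_right hq1]
      · have hq1' := not_le.1 hq1
        have hp1 : 1 ≤ p := by
          by_contra hlt
          exact hA ⟨(not_le.1 hlt).le, ((not_le.1 hlt).trans hq1').le⟩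
        exact unbounded_of_lacunary D hu m (hone (min_eq_left (le_min hp1 hq1'.le))) hp.ne' hpt.ne
          hq1' C
  · exact unbounded_of_lacunary_top D hu m (hone (by simp)) C

end
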